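/- Let μ be a signed Radon measure on the unit disk D with |μ|(D) < τ, and suppose u ∈ L¹(D) weakly solves −Δu = μ with ‖u‖_{L¹(D)} < γ. Then: (i) for every p < 4π/τ there exists β = β(τ,p,γ) such that ∫_{D_{1/2}} e^{p|u|} dx ≤ β; (ii) for every q ∈ [1,2) there exists a threshold τ₀(q) > 0, depending only on q, such that if |μ|(D) < τ₀(q) then ‖e^u‖_{W^{1,q}(D_{1/2})} ≤ β′, where β′ depends only on q, τ₀(q) and γ. -/

import Mathlib

open MeasureTheory Metric Set Filter
open scoped Topology ENNReal NNReal BigOperators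

noncomputable section

abbrev E2 : Type := EuclideanSpace ℝ (Fin 2)

/-- Smooth compactly supported test function. -/
def IsTest (φ : E2 → ℝ) : Prop := ContDiff ℝ (⊤ : ℕ∞) φ ∧ HasCompactSupport φ

/-- Euclidean Laplacian. -/
def lap (φ : E2 → ℝ) (x : E2) : ℝ :=
  ∑ i : Fin 2, fderiv ℝ (fun y => fderiv ℝ φ y (EuclideanSpace.single i (1:ℝ))) x
    (EuclideanSpace.single i (1:ℝ))

/-- Integral of a function against a signed measure. -/
def sInt (μ : SignedMeasure E2) (f : E2 → ℝ) : ℝ :=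
  (∫ x, f x ∂μ.toJordanDecomposition.posPart) - ∫ x, f x ∂μ.toJordanDecomposition.negPart

/-- Total variation measure of a signed measure. -/
def tv (μ : SignedMeasure E2) : Measure E2 := μ.totalVariation

/-- `u` weakly solves `-Δ u = μ` on `Ω`. -/
def WeakPoisson (Ω : Set E2) (u : E2 → ℝ) (μ : SignedMeasure E2) : Prop :=
  ∀ φ : E2 → ℝ, IsTest φ → tsupport φ ⊆ Ω →
    (∫ x in Ω, u x * lap φ x) = - sInt μ φ

/-- `du` is the weak gradient of `u` on `Ω`. -/
def IsWeakGrad (Ω : Set E2) (u : E2 → ℝ) (du : E2 → E2) : Prop :=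
  ∀ φ : E2 → ℝ, IsTest φ → tsupport φ ⊆ Ω → ∀ i : Fin 2,
    (∫ x in Ω, u x * fderiv ℝ φ x (EuclideanSpace.single i (1:ℝ)))
      = - ∫ x in Ω, φ x * du x i

/-- Piecewise C¹ curve on `[0,1]`. -/
def PiecewiseC1 (γ : ℝ → E2) : Prop :=
  ContinuousOn γ (Set.Icc 0 1) ∧
  ∃ (n : ℕ) (t : Fin (n + 1) → ℝ), StrictMono t ∧ t 0 = 0 ∧ t (Fin.last n) = 1 ∧
    ∀ i : Fin n, ContDiffOn ℝ 1 γ (Set.Icc (t i.castSucc) (t i.succ))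

/-- Length of a curve in the conformal metric `e^{2u} g_euc`. -/
def clen (u : E2 → ℝ) (γ : ℝ → E2) : ℝ :=
  ∫ t in (0:ℝ)..1, Real.exp (u (γ t)) * ‖deriv γ t‖

/-- Piecewise C¹ curves in `Ω` from `x` to `y`. -/
def pathsIn (Ω : Set E2) (x y : E2) : Set (ℝ → E2) :=
  {γ | PiecewiseC1 γ ∧ γ 0 = x ∧ γ 1 = y ∧ ∀ t ∈ Set.Icc (0:ℝ) 1, γ t ∈ Ω}

/-- The distance of the conformal metric `e^{2u} g_euc` on `Ω`. -/
def gdist (u : E2 → ℝ) (Ω : Set E2) (x y : E2) : ℝ :=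
  sInf (clen u '' pathsIn Ω x y)


/-- The logarithmic kernel, shifted to be positive on `ball 0 8`. -/
def logKer (z : E2) : ℝ := 1 / (2 * Real.pi) * Real.log (8 / ‖z‖)

/-- The modulus of the gradient of the logarithmic kernel. -/
def gradKer (z : E2) : ℝ := 1 / (2 * Real.pi) * ‖z‖⁻¹

/-- Logarithmic potential of a measure. -/
def logPot (ν : Measure E2) (x : E2) : ℝ := ∫ y, logKer (y - x) ∂ν

/-- Potential of a measure for the kernel `gradKer`. -/
def gradPot (ν : Measure E2) (x : E2) : ℝ := ∫ y, gradKer (y - x) ∂ν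

/-- The normalized Riesz-type kernel `(8 / ‖z‖) ^ a`. -/
def rieszKer (a : ℝ) (z : E2) : ℝ := (8 / ‖z‖) ^ a

lemma measurable_logKer : Measurable logKer := by
  unfold logKer; fun_prop

lemma measurable_gradKer : Measurable gradKer := by
  unfold gradKer; fun_prop

lemma measurable_rieszKer (a : ℝ) : Measurable (rieszKer a) := by
  unfold rieszKer; fun_prop

lemma rieszKer_nonneg (a : ℝ) (z : E2) : 0 ≤ rieszKer a z := by
  unfold rieszKer; positivity

lemma gradKer_nonneg (z : E2) : 0 ≤ gradKer z := by
  unfold gradKer; positivity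

lemma integrableOn_rieszKer {a : ℝ} (ha : a < 2) (r : ℝ) :
    IntegrableOn (rieszKer a) (ball 0 r) volume := by
  refine integrableOn_ball_of_norm_le_rpow (C := 8 ^ a) (α := a) (by simp) (by simpa using ha)
    (Eventually.of_forall fun z => ?_) (measurable_rieszKer a).aestronglyMeasurable
  rw [Real.norm_of_nonneg (rieszKer_nonneg a z), rieszKer, Real.div_rpow (by norm_num) (norm_nonneg _),
    Real.rpow_neg (norm_nonneg _), div_eq_mul_inv]

lemma norm_sub_lt_two {x y : E2} (hx : x ∈ ball (0 : E2) 1) (hy : y ∈ ball (0 : E2) 1) :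
    ‖y - x‖ < 2 := by
  rw [mem_ball_zero_iff] at hx hy
  linarith [norm_sub_le y x]

lemma exists_lintegral_rieszKer_le {a : ℝ} (ha : a < 2) : ∃ C : ℝ≥0∞, C ≠ ∞ ∧
    ∀ y ∈ ball (0 : E2) 1, ∫⁻ x in ball (0 : E2) 1, ENNReal.ofReal (rieszKer a (y - x)) ≤ C := by
  refine ⟨∫⁻ x in ball (0 : E2) 2, ENNReal.ofReal (rieszKer a x),
    ((integrableOn_rieszKer ha 2).lintegral_lt_top).ne, fun y hy => ?_⟩
  rw [← lintegral_indicator measurableSet_ball, ← lintegral_indicator measurableSet_ball,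
    ← lintegral_sub_left_eq_self ((ball (0 : E2) 2).indicator _) y]
  refine lintegral_mono fun x => ?_
  by_cases hx : x ∈ ball (0 : E2) 1
  · have : y - x ∈ ball (0 : E2) 2 := by simpa using norm_sub_lt_two hx hy
    simp [indicator_of_mem hx, indicator_of_mem this]
  · simp [indicator_of_notMem hx]

lemma lintegral_lintegral_rieszKer_le {a : ℝ} {C : ℝ≥0∞}
    (hC : ∀ y ∈ ball (0 : E2) 1,
      ∫⁻ x in ball (0 : E2) 1, ENNReal.ofReal (rieszKer a (y - x)) ≤ C)
    (ν : Measure E2) [IsFiniteMeasure ν] (hν : ∀ᵐ y ∂ν, y ∈ ball (0 : E2) 1) :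
    ∫⁻ x in ball (0 : E2) 1, ∫⁻ y, ENNReal.ofReal (rieszKer a (y - x)) ∂ν ≤ C * ν univ := by
  rw [lintegral_lintegral_swap]
  · calc _ ≤ ∫⁻ y, C ∂ν := lintegral_mono_ae (hν.mono hC)
      _ = _ := by simp
  · exact ((measurable_rieszKer a).comp
      (measurable_snd.sub measurable_fst)).ennreal_ofReal.aemeasurable

lemma ae_integrable_rieszKer {a : ℝ} (ha : a < 2) (ν : Measure E2) [IsFiniteMeasure ν]
    (hν : ∀ᵐ y ∂ν, y ∈ ball (0 : E2) 1) :
    ∀ᵐ x ∂(volume.restrict (ball (0 : E2) 1)), Integrable (fun y => rieszKer a (y - x)) ν := by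
  obtain ⟨C, hC, h⟩ := exists_lintegral_rieszKer_le ha
  have h1 := lintegral_lintegral_rieszKer_le h ν hν
  have h2 := ae_lt_top' (μ := volume.restrict (ball (0 : E2) 1))
    (f := fun x => ∫⁻ y, ENNReal.ofReal (rieszKer a (y - x)) ∂ν)
    (Measurable.lintegral_prod_right' (f := fun p : E2 × E2 => ENNReal.ofReal (rieszKer a (p.2 - p.1)))
      ((measurable_rieszKer a).comp
      (measurable_snd.sub measurable_fst)).ennreal_ofReal).aemeasurable
    (ne_top_of_le_ne_top (ENNReal.mul_ne_top hC (measure_ne_top ν univ)) h1)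
  filter_upwards [h2] with x hx
  refine ⟨((measurable_rieszKer a).comp (measurable_id.sub_const x)).aestronglyMeasurable, ?_⟩
  rw [hasFiniteIntegral_iff_ofReal (Eventually.of_forall fun y => rieszKer_nonneg a _)]
  exact hx

lemma ae_ae_ne (ν : Measure E2) [IsFiniteMeasure ν] :
    ∀ᵐ x ∂(volume : Measure E2), ∀ᵐ y ∂ν, y ≠ x := by
  rw [Measure.ae_ae_comm]
  · refine Eventually.of_forall fun y => ?_
    filter_upwards [compl_mem_ae_iff.2 (measure_singleton (μ := (volume : Measure E2)) y)] with x hx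
    exact fun h => hx h.symm
  · exact (measurableSet_eq_fun measurable_snd measurable_fst).compl

lemma logKer_nonneg {z : E2} (hz : ‖z‖ < 2) : 0 ≤ logKer z := by
  unfold logKer
  rcases (norm_nonneg z).eq_or_lt with h | h
  · simp [← h]
  · have : 1 ≤ 8 / ‖z‖ := by rw [le_div_iff₀ h]; linarith
    have := Real.log_nonneg this
    positivity

lemma logKer_le_gradKer (z : E2) : logKer z ≤ 8 * gradKer z := by
  unfold logKer gradKer
  have : Real.log (8 / ‖z‖) ≤ 8 / ‖z‖ := Real.log_le_self (by positivity)
  have h : 0 < 1 / (2 * Real.pi) := by positivity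
  calc _ ≤ 1 / (2 * Real.pi) * (8 / ‖z‖) := by gcongr
    _ = _ := by ring

lemma gradKer_eq_rieszKer (z : E2) : gradKer z = 1 / (16 * Real.pi) * rieszKer 1 z := by
  unfold gradKer rieszKer
  rw [Real.rpow_one]
  ring

lemma ae_integrable_gradKer (ν : Measure E2) [IsFiniteMeasure ν]
    (hν : ∀ᵐ y ∂ν, y ∈ ball (0 : E2) 1) :
    ∀ᵐ x ∂(volume.restrict (ball (0 : E2) 1)), Integrable (fun y => gradKer (y - x)) ν := by
  filter_upwards [ae_integrable_rieszKer (a := 1) (by norm_num) ν hν] with x hx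
  simpa only [gradKer_eq_rieszKer] using hx.const_mul _

lemma ae_integrable_logKer (ν : Measure E2) [IsFiniteMeasure ν]
    (hν : ∀ᵐ y ∂ν, y ∈ ball (0 : E2) 1) :
    ∀ᵐ x ∂(volume.restrict (ball (0 : E2) 1)), Integrable (fun y => logKer (y - x)) ν := by
  filter_upwards [ae_integrable_gradKer ν hν, ae_restrict_mem measurableSet_ball] with x hx hxB
  refine (hx.const_mul 8).mono'
    (measurable_logKer.comp (measurable_id.sub_const x)).aestronglyMeasurable ?_
  filter_upwards [hν] with y hy
  rw [Real.norm_of_nonneg (logKer_nonneg (norm_sub_lt_two hxB hy))]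
  exact logKer_le_gradKer _

lemma stronglyMeasurable_logPot (ν : Measure E2) [IsFiniteMeasure ν] :
    StronglyMeasurable (logPot ν) :=
  StronglyMeasurable.integral_prod_right (f := fun x y => logKer (y - x))
    (measurable_logKer.comp (measurable_snd.sub measurable_fst)).stronglyMeasurable

lemma stronglyMeasurable_gradPot (ν : Measure E2) [IsFiniteMeasure ν] :
    StronglyMeasurable (gradPot ν) :=
  StronglyMeasurable.integral_prod_right (f := fun x y => gradKer (y - x))
    (measurable_gradKer.comp (measurable_snd.sub measurable_fst)).stronglyMeasurable

lemma gradPot_nonneg (ν : Measure E2) (x : E2) : 0 ≤ gradPot ν x :=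
  integral_nonneg fun _ => gradKer_nonneg _

/-- Brezis–Merle type bound for exponentials of logarithmic potentials. -/
lemma exists_lintegral_exp_logPot_le {τ p : ℝ} (hp : 0 < p) (hpτ : p * τ < 4 * Real.pi) :
    ∃ C : ℝ≥0∞, C ≠ ∞ ∧ ∀ (ν : Measure E2) [IsFiniteMeasure ν],
      (∀ᵐ y ∂ν, y ∈ ball (0 : E2) 1) → ν.real univ ≤ τ →
      ∫⁻ x in ball (0 : E2) 1, ENNReal.ofReal (Real.exp (p * logPot ν x)) ≤ C := by
  have hπ := Real.pi_pos
  set a : ℝ := p * τ / (2 * Real.pi) with ha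
  have ha2 : a < 2 := by rw [ha, div_lt_iff₀ (by positivity)]; linarith
  obtain ⟨C, hC, h⟩ := exists_lintegral_rieszKer_le ha2
  refine ⟨max C (volume (ball (0 : E2) 1)), by simp [hC],
    fun ν _ hν hM => ?_⟩
  rcases eq_or_ne ν 0 with rfl | hν0
  · simp [logPot]
  have : NeZero ν := ⟨hν0⟩
  refine le_trans ?_ (le_max_left _ _)
  have hMpos : 0 < ν.real univ := by
    rw [measureReal_def]; exact ENNReal.toReal_pos (by simpa using hν0) (measure_ne_top _ _)
  have key : ∀ᵐ x ∂(volume.restrict (ball (0 : E2) 1)),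
      ENNReal.ofReal (Real.exp (p * logPot ν x)) ≤
        (ν univ)⁻¹ * ∫⁻ y, ENNReal.ofReal (rieszKer a (y - x)) ∂ν := by
    filter_upwards [ae_integrable_logKer ν hν, ae_integrable_rieszKer ha2 ν hν,
      ae_restrict_mem measurableSet_ball, ae_restrict_of_ae (ae_ae_ne ν)] with x hx1 hx2 hxB hne
    have hle : ∀ᵐ y ∂ν, Real.exp (p * ν.real univ * logKer (y - x)) ≤ rieszKer a (y - x) := by
      filter_upwards [hν, hne] with y hy hyx
      have hpos : 0 < ‖y - x‖ := norm_pos_iff.2 (sub_ne_zero.2 hyx)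
      rw [rieszKer, Real.rpow_def_of_pos (by positivity)]
      have hl := logKer_nonneg (norm_sub_lt_two hxB hy)
      have : p * ν.real univ * logKer (y - x) ≤ p * τ * logKer (y - x) := by gcongr
      refine Real.exp_le_exp.2 (this.trans (le_of_eq ?_))
      rw [logKer, ha]; field_simp
    have hfi : Integrable (fun y => Real.exp (p * ν.real univ * logKer (y - x))) ν := by
      refine hx2.mono' ?_ ?_
      · exact (Real.measurable_exp.comp ((measurable_logKer.comp
          (measurable_id.sub_const x)).const_mul _)).aestronglyMeasurable
      · filter_upwards [hle] with y hy
        rwa [Real.norm_of_nonneg (Real.exp_pos _).le]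
    have hj := convexOn_exp.map_average_le (μ := ν)
      (f := fun y => p * ν.real univ * logKer (y - x)) Real.continuous_exp.continuousOn
      isClosed_univ (by simp) (hx1.const_mul _) hfi
    rw [average_eq, average_eq, integral_const_mul, smul_eq_mul, smul_eq_mul] at hj
    have e1 : (ν.real univ)⁻¹ * (p * ν.real univ * ∫ y, logKer (y - x) ∂ν) = p * logPot ν x := by
      rw [logPot]; field_simp
    rw [e1] at hj
    have h3 : Real.exp (p * logPot ν x) ≤ (ν.real univ)⁻¹ * ∫ y, rieszKer a (y - x) ∂ν :=
      hj.trans (mul_le_mul_of_nonneg_left (integral_mono_ae hfi hx2 hle) (by positivity))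
    refine (ENNReal.ofReal_le_ofReal h3).trans (le_of_eq ?_)
    rw [ENNReal.ofReal_mul (by positivity), ofReal_integral_eq_lintegral_ofReal hx2
      (Eventually.of_forall fun y => rieszKer_nonneg a _), ENNReal.ofReal_inv_of_pos hMpos,
      ofReal_measureReal]
  calc _ ≤ _ := lintegral_mono_ae key
    _ = (ν univ)⁻¹ * ∫⁻ x in ball (0 : E2) 1, ∫⁻ y, ENNReal.ofReal (rieszKer a (y - x)) ∂ν := by
      rw [lintegral_const_mul' _ _ (by simpa using hν0)]
    _ ≤ (ν univ)⁻¹ * (C * ν univ) := by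
      gcongr; exact lintegral_lintegral_rieszKer_le h ν hν
    _ = C := by
      rw [mul_comm, mul_assoc, ENNReal.mul_inv_cancel (by simpa using hν0) (measure_ne_top _ _),
        mul_one]

/-- `L^s` bound, `s < 2`, for the gradient potential of measures of mass at most `τ`. -/
lemma exists_lintegral_gradPot_rpow_le {s τ : ℝ} (hs1 : 1 ≤ s) (hs : s < 2) (hτ : 0 < τ) :
    ∃ C : ℝ≥0∞, C ≠ ∞ ∧ ∀ (ν : Measure E2) [IsFiniteMeasure ν],
      (∀ᵐ y ∂ν, y ∈ ball (0 : E2) 1) → ν.real univ ≤ τ →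
      ∫⁻ x in ball (0 : E2) 1, ENNReal.ofReal (gradPot ν x ^ s) ≤ C := by
  have hπ := Real.pi_pos
  obtain ⟨C, hC, h⟩ := exists_lintegral_rieszKer_le hs
  refine ⟨ENNReal.ofReal (τ ^ s) * C, ENNReal.mul_ne_top ENNReal.ofReal_ne_top hC,
    fun ν _ hν hM => ?_⟩
  rcases eq_or_ne ν 0 with rfl | hν0
  · simp [gradPot, Real.zero_rpow (by linarith : s ≠ 0)]
  have : NeZero ν := ⟨hν0⟩
  have hMpos : 0 < ν.real univ := by
    rw [measureReal_def]; exact ENNReal.toReal_pos (by simpa using hν0) (measure_ne_top _ _)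
  have key : ∀ᵐ x ∂(volume.restrict (ball (0 : E2) 1)),
      ENNReal.ofReal (gradPot ν x ^ s) ≤
        (ENNReal.ofReal (τ ^ s) * (ν univ)⁻¹) * ∫⁻ y, ENNReal.ofReal (rieszKer s (y - x)) ∂ν := by
    filter_upwards [ae_integrable_gradKer ν hν, ae_integrable_rieszKer hs ν hν] with x hx1 hx2
    have hle : ∀ y, gradKer (y - x) ^ s ≤ rieszKer s (y - x) := by
      intro y
      rw [rieszKer, gradKer]
      refine Real.rpow_le_rpow (by positivity) ?_ (by linarith)
      rw [div_eq_mul_inv 8]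
      refine mul_le_mul_of_nonneg_right ?_ (by positivity)
      rw [div_le_iff₀ (by positivity)]
      nlinarith [Real.pi_gt_three]
    have hfi : Integrable (fun y => gradKer (y - x) ^ s) ν := by
      refine hx2.mono' ?_ ?_
      · exact ((measurable_gradKer.comp
          (measurable_id.sub_const x)).pow_const _).aestronglyMeasurable
      · filter_upwards with y
        rw [Real.norm_of_nonneg (Real.rpow_nonneg (gradKer_nonneg _) _)]
        exact hle y
    have hj := (convexOn_rpow hs1).map_average_le (μ := ν)
      (f := fun y => gradKer (y - x))
      (Real.continuous_rpow_const (by linarith)).continuousOn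
      isClosed_Ici (by simp [gradKer_nonneg]) hx1 hfi
    rw [average_eq, average_eq, smul_eq_mul, smul_eq_mul] at hj
    have h3 : gradPot ν x ^ s ≤ (ν.real univ) ^ s *
        ((ν.real univ)⁻¹ * ∫ y, rieszKer s (y - x) ∂ν) := by
      calc gradPot ν x ^ s = (ν.real univ * ((ν.real univ)⁻¹ * ∫ y, gradKer (y - x) ∂ν)) ^ s := by
            rw [gradPot]; congr 1; field_simp
        _ = (ν.real univ) ^ s * ((ν.real univ)⁻¹ * ∫ y, gradKer (y - x) ∂ν) ^ s := by
            rw [Real.mul_rpow (by positivity)]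
            exact mul_nonneg (by positivity) (gradPot_nonneg ν x)
        _ ≤ _ := by
            refine mul_le_mul_of_nonneg_left (hj.trans ?_) (by positivity)
            exact mul_le_mul_of_nonneg_left (integral_mono hfi hx2 hle) (by positivity)
    have h4 : 0 ≤ (ν.real univ)⁻¹ * ∫ y, rieszKer s (y - x) ∂ν :=
      mul_nonneg (by positivity) (integral_nonneg fun y => rieszKer_nonneg _ _)
    have h5 : gradPot ν x ^ s ≤ τ ^ s *
        ((ν.real univ)⁻¹ * ∫ y, rieszKer s (y - x) ∂ν) :=
      h3.trans (mul_le_mul_of_nonneg_right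
        (Real.rpow_le_rpow (by positivity) hM (by linarith)) h4)
    refine (ENNReal.ofReal_le_ofReal h5).trans (le_of_eq ?_)
    rw [ENNReal.ofReal_mul (by positivity), ENNReal.ofReal_mul (by positivity),
      ofReal_integral_eq_lintegral_ofReal hx2
      (Eventually.of_forall fun y => rieszKer_nonneg s _), ENNReal.ofReal_inv_of_pos hMpos,
      ofReal_measureReal, mul_assoc]
  calc _ ≤ _ := lintegral_mono_ae key
    _ = (ENNReal.ofReal (τ ^ s) * (ν univ)⁻¹) *
        ∫⁻ x in ball (0 : E2) 1, ∫⁻ y, ENNReal.ofReal (rieszKer s (y - x)) ∂ν := by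
      rw [lintegral_const_mul' _ _ (ENNReal.mul_ne_top ENNReal.ofReal_ne_top (by simpa using hν0))]
    _ ≤ (ENNReal.ofReal (τ ^ s) * (ν univ)⁻¹) * (C * ν univ) := by
      gcongr; exact lintegral_lintegral_rieszKer_le h ν hν
    _ = ENNReal.ofReal (τ ^ s) * C * ((ν univ)⁻¹ * ν univ) := by ring
    _ = ENNReal.ofReal (τ ^ s) * C := by
      rw [ENNReal.inv_mul_cancel (by simpa using hν0) (measure_ne_top _ _), mul_one]

/-- Regularized logarithmic kernel. -/
def regLog (e : ℝ) (z : E2) : ℝ := 1 / (4 * Real.pi) * Real.log (‖z‖ ^ 2 + e)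

/-- Gradient of the regularized logarithmic kernel. -/
def regGrad (e : ℝ) (z : E2) : E2 := (1 / (2 * Real.pi) * (‖z‖ ^ 2 + e)⁻¹) • z

/-- Second derivative of the regularized logarithmic kernel, applied to a vector. -/
def regHess (e : ℝ) (z v : E2) : E2 :=
  (1 / (2 * Real.pi) * (‖z‖ ^ 2 + e)⁻¹) • v
    - (1 / Real.pi * inner ℝ z v * ((‖z‖ ^ 2 + e) ^ 2)⁻¹) • z

/-- Laplacian of the regularized logarithmic kernel. -/
def regDelta (e : ℝ) (z : E2) : ℝ := 1 / Real.pi * (e * ((‖z‖ ^ 2 + e) ^ 2)⁻¹)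

/-- Coordinate directions. -/
abbrev dir (i : Fin 2) : E2 := EuclideanSpace.single i (1 : ℝ)

lemma inner_dir (z : E2) (i : Fin 2) : inner ℝ z (dir i) = z i := by
  simp [dir, EuclideanSpace.inner_single_right]

lemma norm_dir (i : Fin 2) : ‖dir i‖ = 1 := by simp [dir]

lemma sum_regHess {e : ℝ} (he : 0 < e) (z : E2) :
    ∑ i : Fin 2, regHess e z (dir i) i = regDelta e z := by
  have hs : ‖z‖ ^ 2 + e ≠ 0 := by positivity
  have hz : ‖z‖ ^ 2 = z 0 ^ 2 + z 1 ^ 2 := by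
    rw [EuclideanSpace.norm_sq_eq]; simp
  simp only [regHess, inner_dir, Fin.sum_univ_two, regDelta, PiLp.sub_apply, PiLp.smul_apply,
    smul_eq_mul]
  simp only [dir, PiLp.single_apply, if_true]
  have hπ := Real.pi_ne_zero
  have h0 : z 0 ^ 2 = ‖z‖ ^ 2 - z 1 ^ 2 := by rw [hz]; ring
  field_simp
  rw [h0]
  ring

lemma contDiff_regLog {e : ℝ} (he : 0 < e) {n : WithTop ℕ∞} : ContDiff ℝ n (regLog e) := by
  unfold regLog
  refine contDiff_const.mul (ContDiff.log ?_ fun z => by positivity)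
  exact (contDiff_norm_sq ℝ).add contDiff_const

lemma hasFDerivAt_regLog {e : ℝ} (he : 0 < e) (z : E2) :
    HasFDerivAt (regLog e) (innerSL ℝ (regGrad e z)) z := by
  have hs : ‖z‖ ^ 2 + e ≠ 0 := by positivity
  have h1 : HasFDerivAt (fun z : E2 => ‖z‖ ^ 2 + e) (2 • innerSL ℝ z) z :=
    ((hasStrictFDerivAt_norm_sq z).hasFDerivAt).add_const e
  refine ((h1.log hs).const_mul (1 / (4 * Real.pi))).congr_fderiv ?_
  ext v
  simp [regGrad]
  field_simp
  norm_num

lemma hasFDerivAt_regGrad {e : ℝ} (he : 0 < e) (z : E2) :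
    ∃ L : E2 →L[ℝ] E2, HasFDerivAt (regGrad e) L z ∧ ∀ v, L v = regHess e z v := by
  have hs : ‖z‖ ^ 2 + e ≠ 0 := by positivity
  have h1 : HasFDerivAt (fun z : E2 => ‖z‖ ^ 2 + e) (2 • innerSL ℝ z) z :=
    ((hasStrictFDerivAt_norm_sq z).hasFDerivAt).add_const e
  have h2 := (((hasDerivAt_inv hs).comp_hasFDerivAt z h1).const_mul (1 / (2 * Real.pi))).smul (hasFDerivAt_id z)
  refine ⟨_, h2, fun v => ?_⟩
  simp [regHess]
  rw [sub_eq_add_neg, ← neg_smul]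
  congr 2
  field_simp
  rw [neg_smul]

lemma continuous_regLog {e : ℝ} (he : 0 < e) : Continuous (regLog e) :=
  (contDiff_regLog (n := 0) he).continuous

lemma continuous_inv_normSq_add {e : ℝ} (he : 0 < e) :
    Continuous fun z : E2 => (‖z‖ ^ 2 + e)⁻¹ :=
  Continuous.inv₀ (f := fun z : E2 => ‖z‖ ^ 2 + e) (by fun_prop) fun z => by positivity

lemma continuous_regGrad {e : ℝ} (he : 0 < e) : Continuous (regGrad e) := by
  have := continuous_inv_normSq_add he
  unfold regGrad
  fun_prop

lemma continuous_regHess {e : ℝ} (he : 0 < e) (v : E2) : Continuous fun z => regHess e z v := by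
  have := continuous_inv_normSq_add he
  unfold regHess
  simp only [← inv_pow]
  fun_prop

lemma continuous_regDelta {e : ℝ} (he : 0 < e) : Continuous (regDelta e) := by
  unfold regDelta
  refine continuous_const.mul (continuous_const.mul (Continuous.inv₀ (by fun_prop) fun z => ?_))
  positivity

lemma regDelta_nonneg {e : ℝ} (he : 0 ≤ e) (z : E2) : 0 ≤ regDelta e z := by
  unfold regDelta; positivity

lemma regDelta_le {e : ℝ} (he : 0 < e) (z : E2) : regDelta e z ≤ 1 / (Real.pi * e) := by
  unfold regDelta
  have h1 : ((‖z‖ ^ 2 + e) ^ 2)⁻¹ ≤ (e ^ 2)⁻¹ := by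
    gcongr
    nlinarith [sq_nonneg ‖z‖]
  calc _ ≤ 1 / Real.pi * (e * (e ^ 2)⁻¹) := by gcongr
    _ = _ := by field_simp

lemma norm_regGrad_le {e : ℝ} (he : 0 ≤ e) (z : E2) : ‖regGrad e z‖ ≤ gradKer z := by
  rw [regGrad, norm_smul, gradKer, Real.norm_of_nonneg (by positivity), mul_assoc]
  gcongr
  rcases (norm_nonneg z).eq_or_lt with h | h
  · simp [← h]
  · rw [inv_mul_le_iff₀ (by positivity)]
    field_simp
    linarith

lemma norm_regGrad_le_of_pos {e : ℝ} (he : 0 < e) (z : E2) : ‖regGrad e z‖ ≤ 1 + 1 / e := by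
  have hs : 0 < ‖z‖ ^ 2 + e := by positivity
  rw [regGrad, norm_smul, Real.norm_of_nonneg (by positivity), mul_assoc]
  have h1 : (‖z‖ ^ 2 + e)⁻¹ * ‖z‖ ≤ 1 + 1 / e := by
    rw [inv_mul_le_iff₀ hs]
    have : (‖z‖ ^ 2 + e) * (1 + 1 / e) = ‖z‖ ^ 2 + e + ‖z‖ ^ 2 / e + 1 := by
      field_simp; ring
    rw [this]
    have : 0 ≤ ‖z‖ ^ 2 / e := by positivity
    nlinarith [sq_nonneg (‖z‖ - 1)]
  have h2 : 1 / (2 * Real.pi) ≤ 1 := by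
    rw [div_le_one (by positivity)]; linarith [Real.pi_gt_three]
  calc _ ≤ 1 * ((‖z‖ ^ 2 + e)⁻¹ * ‖z‖) := by gcongr
    _ ≤ _ := by rwa [one_mul]

lemma norm_regHess_le {e : ℝ} {z : E2} {m : ℝ} (hm : 0 < m) (h : m ≤ ‖z‖ ^ 2 + e) (he : 0 ≤ e)
    (v : E2) : ‖regHess e z v‖ ≤ 2 / m * ‖v‖ := by
  have hs : 0 < ‖z‖ ^ 2 + e := hm.trans_le h
  have hπ : 3 < Real.pi := Real.pi_gt_three
  set s := ‖z‖ ^ 2 + e with hsd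
  have e1 : ‖(1 / (2 * Real.pi) * s⁻¹) • v‖ ≤ 1 / s * ‖v‖ := by
    rw [norm_smul, Real.norm_of_nonneg (by positivity), one_div s]
    gcongr
    have : 1 / (2 * Real.pi) ≤ 1 := by
      rw [div_le_one (by positivity)]; linarith
    exact mul_le_of_le_one_left (by positivity) this
  have e2 : ‖(1 / Real.pi * inner ℝ z v * (s ^ 2)⁻¹) • z‖ ≤ 1 / s * ‖v‖ := by
    rw [norm_smul, norm_mul, norm_mul, Real.norm_of_nonneg (by positivity : 0 ≤ 1 / Real.pi),
      Real.norm_of_nonneg (by positivity : 0 ≤ (s ^ 2)⁻¹)]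
    have : 1 / Real.pi ≤ 1 := by
      rw [div_le_one (by positivity)]; linarith
    calc _ ≤ 1 * (‖z‖ * ‖v‖) * (s ^ 2)⁻¹ * ‖z‖ := by
          gcongr
          exact norm_inner_le_norm z v
      _ = ‖z‖ ^ 2 * (s ^ 2)⁻¹ * ‖v‖ := by ring
      _ ≤ s * (s ^ 2)⁻¹ * ‖v‖ := by gcongr; linarith
      _ = 1 / s * ‖v‖ := by field_simp
  have e3 : 1 / s ≤ 1 / m := by gcongr
  calc ‖regHess e z v‖ ≤ 1 / s * ‖v‖ + 1 / s * ‖v‖ := (norm_sub_le _ _).trans (add_le_add e1 e2)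
    _ ≤ 1 / m * ‖v‖ + 1 / m * ‖v‖ := by gcongr
    _ = _ := by ring

lemma abs_regLog_le {e : ℝ} (he : 0 ≤ e) (he1 : e ≤ 1) {z : E2} (hz : 0 < ‖z‖) (hz2 : ‖z‖ < 2) :
    |regLog e z| ≤ logKer z := by
  have hπ := Real.pi_pos
  have h64 : Real.log (8 / ‖z‖) = 1 / 2 * Real.log (64 / ‖z‖ ^ 2) := by
    rw [show (64 : ℝ) / ‖z‖ ^ 2 = (8 / ‖z‖) ^ 2 by rw [div_pow]; norm_num, Real.log_pow]
    push_cast; ring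
  have hk : logKer z = 1 / (4 * Real.pi) * Real.log (64 / ‖z‖ ^ 2) := by
    rw [logKer, h64]; ring
  rw [regLog, hk, abs_mul, abs_of_nonneg (by positivity : 0 ≤ 1 / (4 * Real.pi))]
  gcongr
  rw [abs_le]
  have hs : 0 < ‖z‖ ^ 2 + e := by positivity
  have hz4 : ‖z‖ ^ 2 < 4 := by nlinarith
  constructor
  · rw [← Real.log_inv]
    apply Real.log_le_log (by positivity)
    rw [inv_div, div_le_iff₀ (by norm_num)]
    nlinarith
  · apply Real.log_le_log (by positivity)
    rw [le_div_iff₀ (by positivity)]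
    nlinarith [sq_nonneg ‖z‖]

lemma tendsto_regLog {e : ℕ → ℝ} (he : Tendsto e atTop (𝓝 0)) {z : E2} (hz : z ≠ 0) :
    Tendsto (fun n => regLog (e n) z) atTop (𝓝 (regLog 0 z)) := by
  have hs : ‖z‖ ^ 2 + 0 ≠ 0 := by simpa using hz
  unfold regLog
  exact ((tendsto_const_nhds.add he).log hs).const_mul _

lemma tendsto_regGrad {e : ℕ → ℝ} (he : Tendsto e atTop (𝓝 0)) {z : E2} (hz : z ≠ 0) :
    Tendsto (fun n => regGrad (e n) z) atTop (𝓝 (regGrad 0 z)) := by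
  have hs : ‖z‖ ^ 2 + 0 ≠ 0 := by simpa using hz
  unfold regGrad
  exact (((tendsto_const_nhds.add he).inv₀ hs).const_mul _).smul_const z

lemma tendsto_regHess {e : ℕ → ℝ} (he : Tendsto e atTop (𝓝 0)) {z : E2} (hz : z ≠ 0) (v : E2) :
    Tendsto (fun n => regHess (e n) z v) atTop (𝓝 (regHess 0 z v)) := by
  have hs : ‖z‖ ^ 2 + 0 ≠ 0 := by simpa using hz
  unfold regHess
  exact ((((tendsto_const_nhds.add he).inv₀ hs).const_mul _).smul_const v).sub
    (((((tendsto_const_nhds.add he).pow 2).inv₀ (pow_ne_zero 2 hs)).const_mul _).smul_const z)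

lemma hasLineDerivAt_comp_const_sub {F : Type*} [NormedAddCommGroup F] [NormedSpace ℝ F]
    {f : E2 → F} {L : E2 →L[ℝ] F} {x y : E2} (h : HasFDerivAt f L (y - x)) (v : E2) :
    HasLineDerivAt ℝ (fun x => f (y - x)) (-L v) x v := by
  have h1 : HasFDerivAt (fun x => f (y - x)) (L.comp (-ContinuousLinearMap.id ℝ E2)) x :=
    HasFDerivAt.comp x h ((hasFDerivAt_id x).const_sub y)
  simpa using h1.hasLineDerivAt v

lemma fderiv_regLog_sub {e : ℝ} (he : 0 < e) (x y : E2) :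
    HasFDerivAt (fun y => regLog e (y - x)) (innerSL ℝ (regGrad e (y - x))) y := by
  exact (hasFDerivAt_regLog he (y - x)).comp y ((hasFDerivAt_id y).sub_const x)

/-- Cross terms in the Laplacian of `η * regLog e (· - x)`. -/
def crossKer (η : E2 → ℝ) (e : ℝ) (x y : E2) : ℝ :=
  2 * fderiv ℝ η y (regGrad e (y - x)) + regLog e (y - x) * lap η y

/-- Derivative of `crossKer` in its first variable. -/
def crossKerDeriv (η : E2 → ℝ) (e : ℝ) (v x y : E2) : ℝ :=
  -(2 * fderiv ℝ η y (regHess e (y - x) v) + inner ℝ (regGrad e (y - x)) v * lap η y)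

lemma map_eq_sum_dir (L : E2 →L[ℝ] ℝ) (w : E2) : L w = ∑ i, w i * L (dir i) := by
  conv_lhs => rw [← (EuclideanSpace.basisFun (Fin 2) ℝ).sum_repr w]
  simp [dir]

lemma lap_mul_regLog {η : E2 → ℝ} (hη : ContDiff ℝ (⊤ : ℕ∞) η) {e : ℝ} (he : 0 < e) (x y : E2) :
    lap (fun y => η y * regLog e (y - x)) y = η y * regDelta e (y - x) + crossKer η e x y := by
  have hd : Differentiable ℝ η := hη.differentiable (by simp)
  have hd' : ∀ i, Differentiable ℝ fun y => fderiv ℝ η y (dir i) := fun i =>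
    ((hη.fderiv_right (m := (⊤ : ℕ∞)) (by simp)).clm_apply contDiff_const).differentiable (by simp)
  have h1 : ∀ i : Fin 2, (fun y => fderiv ℝ (fun y => η y * regLog e (y - x)) y (dir i)) =
      fun y => η y * regGrad e (y - x) i + regLog e (y - x) * fderiv ℝ η y (dir i) := by
    intro i
    ext y
    have := (hd y).hasFDerivAt.mul (fderiv_regLog_sub he x y)
    rw [show (fun y => η y * regLog e (y - x)) = η * fun y => regLog e (y - x) from rfl,
      HasFDerivAt.fderiv this]
    simp [dir, EuclideanSpace.inner_single_right]
  have h2 : ∀ i : Fin 2,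
      fderiv ℝ (fun y => fderiv ℝ (fun y => η y * regLog e (y - x)) y (dir i)) y (dir i) =
        η y * regHess e (y - x) (dir i) i + 2 * (regGrad e (y - x) i * fderiv ℝ η y (dir i)) +
        regLog e (y - x) * fderiv ℝ (fun y => fderiv ℝ η y (dir i)) y (dir i) := by
    intro i
    rw [h1 i]
    obtain ⟨L, hL, hLv⟩ := hasFDerivAt_regGrad he (y - x)
    have hG : HasFDerivAt (fun y => regGrad e (y - x) i)
        ((EuclideanSpace.proj i : E2 →L[ℝ] ℝ).comp L) y :=
      (EuclideanSpace.proj i : E2 →L[ℝ] ℝ).hasFDerivAt.comp y ((hasFDerivAt_comp_sub x).2 hL)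
    have := ((hd y).hasFDerivAt.mul hG).add ((fderiv_regLog_sub he x y).mul (hd' i y).hasFDerivAt)
    rw [show (fun y => η y * (regGrad e (y - x)).ofLp i +
      regLog e (y - x) * fderiv ℝ η y (dir i)) = ((η * fun y => regGrad e (y - x) i) +
      (fun y => regLog e (y - x)) * fun y => fderiv ℝ η y (dir i)) from rfl,
      HasFDerivAt.fderiv this]
    simp [hLv, inner_dir]
    ring
  unfold lap crossKer
  rw [Finset.sum_congr rfl fun i _ => h2 i, Finset.sum_add_distrib, Finset.sum_add_distrib,
    ← Finset.mul_sum, sum_regHess he, map_eq_sum_dir (fderiv ℝ η y) (regGrad e (y - x)),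
    ← Finset.mul_sum, ← Finset.mul_sum, lap]
  ring

lemma hasLineDerivAt_regLog_sub {e : ℝ} (he : 0 < e) (v x y : E2) :
    HasLineDerivAt ℝ (fun x => regLog e (y - x)) (-inner ℝ (regGrad e (y - x)) v) x v := by
  simpa using hasLineDerivAt_comp_const_sub (hasFDerivAt_regLog he (y - x)) v

lemma hasLineDerivAt_crossKer (η : E2 → ℝ) {e : ℝ} (he : 0 < e) (v x y : E2) :
    HasLineDerivAt ℝ (fun x => crossKer η e x y) (crossKerDeriv η e v x y) x v := by
  obtain ⟨L, hL, hLv⟩ := hasFDerivAt_regGrad he (y - x)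
  have h1 := hasLineDerivAt_comp_const_sub ((fderiv ℝ η y).hasFDerivAt.comp (y - x) hL) v
  have h2 := (HasDerivAt.const_mul 2 h1).add
    (HasDerivAt.mul_const (hasLineDerivAt_regLog_sub he v x y) (lap η y))
  refine HasDerivAt.congr_deriv h2 ?_
  simp [crossKerDeriv, hLv]
  ring

/-- The sequence of regularization parameters. -/
def eps (n : ℕ) : ℝ := (((n : ℝ) + 1) ^ 2)⁻¹

lemma eps_pos (n : ℕ) : 0 < eps n := by unfold eps; positivity

lemma eps_le_one (n : ℕ) : eps n ≤ 1 := by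
  unfold eps
  apply inv_le_one_of_one_le₀
  have : (0 : ℝ) ≤ n := by positivity
  nlinarith

lemma tendsto_eps : Tendsto eps atTop (𝓝 0) := by
  unfold eps
  refine tendsto_inv_atTop_zero.comp ((tendsto_pow_atTop two_ne_zero).comp ?_)
  exact tendsto_atTop_add_const_right _ _ tendsto_natCast_atTop_atTop

lemma integrable_regDelta_and_integral_eq_one {e : ℝ} (he : 0 < e) :
    Integrable (regDelta e) (volume : Measure E2) ∧ ∫ z, regDelta e z = 1 := by
  have hπ := Real.pi_pos
  set f : ℝ → ℝ := fun y => 1 / Real.pi * (e * ((y ^ 2 + e) ^ 2)⁻¹) with hf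
  have hder : ∀ y ∈ Ioi (0 : ℝ), HasDerivAt (fun y => -(1 / (2 * Real.pi) * e) * (y ^ 2 + e)⁻¹)
      (y ^ (Module.finrank ℝ E2 - 1) • f y) y := by
    intro y _
    have hs : y ^ 2 + e ≠ 0 := by positivity
    have h1 : HasDerivAt (fun y : ℝ => y ^ 2 + e) (2 * y) y := by
      simpa using (hasDerivAt_pow 2 y).add_const e
    refine ((h1.fun_inv hs).const_mul (-(1 / (2 * Real.pi) * e))).congr_deriv ?_
    simp [hf]
    field_simp
  have hcont : Continuous fun y : ℝ => -(1 / (2 * Real.pi) * e) * (y ^ 2 + e)⁻¹ :=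
    continuous_const.mul (Continuous.inv₀ (by fun_prop) fun z => by positivity)
  have hlim : Tendsto (fun y : ℝ => -(1 / (2 * Real.pi) * e) * (y ^ 2 + e)⁻¹) atTop (𝓝 0) := by
    have : Tendsto (fun y : ℝ => (y ^ 2 + e)⁻¹) atTop (𝓝 0) :=
      tendsto_inv_atTop_zero.comp (tendsto_atTop_add_const_right _ _
        (tendsto_pow_atTop two_ne_zero))
    simpa using this.const_mul (-(1 / (2 * Real.pi) * e))
  have hpos : ∀ y ∈ Ioi (0 : ℝ), 0 ≤ y ^ (Module.finrank ℝ E2 - 1) • f y := by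
    intro y hy
    have : (0 : ℝ) < y := hy
    simp only [hf, smul_eq_mul]; positivity
  have hI := integrableOn_Ioi_deriv_of_nonneg hcont.continuousWithinAt hder hpos hlim
  refine ⟨(integrable_fun_norm_addHaar (volume : Measure E2) (f := f)).2 hI, ?_⟩
  have h2 := integral_fun_norm_addHaar (volume : Measure E2) f
  rw [integral_Ioi_of_hasDerivAt_of_tendsto hcont.continuousWithinAt hder hI hlim] at h2
  change ∫ z : E2, f ‖z‖ = 1
  rw [h2, measureReal_def, EuclideanSpace.volume_ball_fin_two]
  simp
  field_simp
  exact ENNReal.toReal_ofReal hπ.le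

lemma regDelta_eps (n : ℕ) (z : E2) :
    regDelta (eps n) z = ((n : ℝ) + 1) ^ 2 * regDelta 1 (((n : ℝ) + 1) • z) := by
  unfold regDelta eps
  rw [norm_smul, Real.norm_of_nonneg (by positivity)]
  have : (0 : ℝ) < (n : ℝ) + 1 := by positivity
  have h2 : 0 < ‖z‖ ^ 2 + (((n : ℝ) + 1) ^ 2)⁻¹ := by positivity
  have h3 : (((n : ℝ) + 1) * ‖z‖) ^ 2 + 1 =
      ((n : ℝ) + 1) ^ 2 * (‖z‖ ^ 2 + (((n : ℝ) + 1) ^ 2)⁻¹) := by field_simp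
  rw [h3]
  generalize ‖z‖ ^ 2 + (((n : ℝ) + 1) ^ 2)⁻¹ = s at h2
  field_simp

lemma tendsto_norm_sq_mul_regDelta :
    Tendsto (fun z : E2 => ‖z‖ ^ Module.finrank ℝ E2 * regDelta 1 z)
      (Bornology.cobounded E2) (𝓝 0) := by
  have h1 : Tendsto (fun z : E2 => (‖z‖ ^ 2)⁻¹) (Bornology.cobounded E2) (𝓝 0) :=
    tendsto_inv_atTop_zero.comp ((tendsto_pow_atTop two_ne_zero).comp tendsto_norm_cobounded_atTop)
  refine squeeze_zero (fun z => mul_nonneg (by positivity) (regDelta_nonneg zero_le_one z)) ?_ h1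
  intro z
  have hπ := Real.pi_gt_three
  rw [finrank_euclideanSpace_fin, regDelta]
  rcases (norm_nonneg z).eq_or_lt with h | h
  · simp [← h]
  have h2 : 1 / Real.pi ≤ 1 := by rw [div_le_one (by positivity)]; linarith
  calc ‖z‖ ^ 2 * (1 / Real.pi * (1 * ((‖z‖ ^ 2 + 1) ^ 2)⁻¹))
      ≤ ‖z‖ ^ 2 * (1 * (1 * ((‖z‖ ^ 2) ^ 2)⁻¹)) := by
        gcongr; linarith
    _ = (‖z‖ ^ 2)⁻¹ := by field_simp

lemma tendsto_integral_mul_regDelta {φ : E2 → ℝ} (hφ : Continuous φ) (hc : HasCompactSupport φ)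
    (y : E2) :
    Tendsto (fun n => ∫ x, φ x * regDelta (eps n) (y - x)) atTop (𝓝 (φ y)) := by
  have h := tendsto_integral_comp_smul_smul_of_integrable' (μ := (volume : Measure E2))
    (regDelta_nonneg zero_le_one) (integrable_regDelta_and_integral_eq_one one_pos).2
    tendsto_norm_sq_mul_regDelta (x₀ := y) (hφ.integrable_of_hasCompactSupport hc) hφ.continuousAt
  have h2 : Tendsto (fun n : ℕ => (n : ℝ) + 1) atTop atTop :=
    tendsto_atTop_add_const_right _ _ tendsto_natCast_atTop_atTop
  refine (h.comp h2).congr fun n => integral_congr_ae (Eventually.of_forall fun x => ?_)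
  simp only [finrank_euclideanSpace_fin, smul_eq_mul]
  rw [regDelta_eps, mul_comm]

lemma tendsto_integral_mul_mollification {f φ : E2 → ℝ} (hf : Integrable f) (hφ : Continuous φ)
    (hc : HasCompactSupport φ) :
    Tendsto (fun n => ∫ x, φ x * ∫ y, f y * regDelta (eps n) (y - x)) atTop
      (𝓝 (∫ y, f y * φ y)) := by
  obtain ⟨C, hC⟩ := hc.exists_bound_of_continuous hφ
  have hswap : ∀ n, ∫ x, φ x * ∫ y, f y * regDelta (eps n) (y - x) =
      ∫ y, f y * ∫ x, φ x * regDelta (eps n) (y - x) := by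
    intro n
    simp only [← integral_const_mul]
    rw [integral_integral_swap]
    · refine integral_congr_ae (Eventually.of_forall fun y =>
        integral_congr_ae (Eventually.of_forall fun x => ?_))
      simp only
      ring
    · have h1 : Integrable (fun p : E2 × E2 => φ p.1 * f p.2) (volume.prod volume) :=
        (hφ.integrable_of_hasCompactSupport hc).mul_prod hf
      have h2 : Continuous fun p : E2 × E2 => regDelta (eps n) (p.2 - p.1) :=
        (continuous_regDelta (eps_pos n)).comp (by fun_prop)
      have h3 := h1.mul_bdd (c := 1 / (Real.pi * eps n)) h2.aestronglyMeasurable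
        (Eventually.of_forall fun p => by
          rw [Real.norm_of_nonneg (regDelta_nonneg (eps_pos n).le _)]
          exact regDelta_le (eps_pos n) _)
      refine h3.congr (Eventually.of_forall fun p => ?_)
      simp only [Function.uncurry]
      ring
  simp only [hswap]
  refine tendsto_integral_of_dominated_convergence (fun y => |f y| * C) ?_ (hf.abs.mul_const C)
    ?_ (Eventually.of_forall fun y => (tendsto_integral_mul_regDelta hφ hc y).const_mul _)
  · intro n
    refine hf.aestronglyMeasurable.mul (Continuous.aestronglyMeasurable ?_)
    refine continuous_of_dominated (bound := fun x => |φ x| * (1 / (Real.pi * eps n)))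
      (fun y => ?_) (fun y => Eventually.of_forall fun x => ?_)
      ((hφ.integrable_of_hasCompactSupport hc).abs.mul_const _) (Eventually.of_forall fun x => ?_)
    · exact (hφ.mul ((continuous_regDelta (eps_pos n)).comp
        (continuous_const.sub continuous_id))).aestronglyMeasurable
    · rw [norm_mul, Real.norm_eq_abs, Real.norm_of_nonneg (regDelta_nonneg (eps_pos n).le _)]
      gcongr
      exact regDelta_le (eps_pos n) _
    · exact continuous_const.mul ((continuous_regDelta (eps_pos n)).comp (by fun_prop))
  · intro n
    refine Eventually.of_forall fun y => ?_
    rw [norm_mul, Real.norm_eq_abs]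
    gcongr
    obtain ⟨hi, h1⟩ := integrable_regDelta_and_integral_eq_one (eps_pos n)
    calc ‖∫ x, φ x * regDelta (eps n) (y - x)‖ ≤ ∫ x, C * regDelta (eps n) (y - x) := by
          refine norm_integral_le_of_norm_le ((hi.comp_sub_left y).const_mul C)
            (Eventually.of_forall fun x => ?_)
          rw [norm_mul, Real.norm_of_nonneg (regDelta_nonneg (eps_pos n).le _)]
          exact mul_le_mul_of_nonneg_right (hC x) (regDelta_nonneg (eps_pos n).le _)
      _ = C := by
        rw [integral_const_mul, integral_sub_left_eq_self (regDelta (eps n)) volume y, h1, mul_one]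

/-- A smooth cutoff in the unit disk, equal to one on `ball 0 ρ` and whose derivatives
live at distance at least `d` from `ball 0 ρ`. -/
structure IsCutoff (ρ d : ℝ) (η : E2 → ℝ) : Prop where
  contDiff : ContDiff ℝ (⊤ : ℕ∞) η
  hasCompactSupport : HasCompactSupport η
  tsupport_subset : tsupport η ⊆ ball 0 1
  nonneg : ∀ y, 0 ≤ η y
  le_one : ∀ y, η y ≤ 1
  eq_one : ∀ y ∈ ball (0 : E2) ρ, η y = 1
  fderiv_eq_zero : ∀ y, ‖y‖ < ρ + d → fderiv ℝ η y = 0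
  lap_eq_zero : ∀ y, ‖y‖ < ρ + d → lap η y = 0

lemma exists_isCutoff {ρ : ℝ} (h0 : 0 < ρ) (h1 : ρ < 1) :
    ∃ d > 0, ∃ η : E2 → ℝ, IsCutoff ρ d η := by
  set d := (1 - ρ) / 3 with hd
  have hd0 : 0 < d := by rw [hd]; linarith
  let b : ContDiffBump (0 : E2) := ⟨ρ + d, ρ + 2 * d, by linarith, by linarith⟩
  have hloc : ∀ y : E2, ‖y‖ < ρ + d → (b : E2 → ℝ) =ᶠ[𝓝 y] fun _ => 1 := fun y hy =>
    b.eventuallyEq_one_of_mem_ball (by simpa [b] using hy)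
  have hfd : ∀ y : E2, ‖y‖ < ρ + d → fderiv ℝ b y = 0 := fun y hy => by
    rw [(hloc y hy).fderiv_eq]; simp
  refine ⟨d, hd0, b, b.contDiff, b.hasCompactSupport, ?_, fun y => b.nonneg, fun y => b.le_one,
    fun y hy => b.one_of_mem_closedBall ?_, hfd, fun y hy => ?_⟩
  · rw [b.tsupport_eq]
    refine closedBall_subset_ball ?_
    change ρ + 2 * d < 1
    linarith
  · have : ‖y‖ < ρ := by simpa using hy
    have h2 : ‖y‖ ≤ ρ + d := by linarith
    simpa [b] using h2
  · unfold lap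
    refine Finset.sum_eq_zero fun i _ => ?_
    have : (fun y => fderiv ℝ b y (EuclideanSpace.single i (1 : ℝ))) =ᶠ[𝓝 y] fun _ => 0 := by
      filter_upwards [(isOpen_lt continuous_norm continuous_const).mem_nhds hy] with z hz
      rw [hfd z hz]; simp
    rw [this.fderiv_eq]; simp

lemma continuous_lap {η : E2 → ℝ} (hη : ContDiff ℝ (⊤ : ℕ∞) η) : Continuous (lap η) := by
  unfold lap
  refine continuous_finsetSum _ fun i _ => ?_
  have h1 : ContDiff ℝ (⊤ : ℕ∞) fun y => fderiv ℝ η y (EuclideanSpace.single i (1 : ℝ)) :=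
    (hη.fderiv_right (m := (⊤ : ℕ∞)) (by simp)).clm_apply contDiff_const
  exact (h1.continuous_fderiv (by simp)).clm_apply continuous_const

namespace IsCutoff

variable {ρ d : ℝ} {η : E2 → ℝ}

lemma eq_zero (h : IsCutoff ρ d η) {y : E2} (hy : y ∉ ball (0 : E2) 1) : η y = 0 :=
  image_eq_zero_of_notMem_tsupport fun hy' => hy (h.tsupport_subset hy')

lemma continuous_fderiv (h : IsCutoff ρ d η) : Continuous (fderiv ℝ η) :=
  h.contDiff.continuous_fderiv (by simp)

lemma exists_bound (h : IsCutoff ρ d η) :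
    ∃ K, 0 ≤ K ∧ ∀ y ∈ ball (0 : E2) 1, ‖fderiv ℝ η y‖ ≤ K ∧ |lap η y| ≤ K := by
  obtain ⟨A, hA⟩ := (isCompact_closedBall (0 : E2) 1).exists_bound_of_continuousOn
    h.continuous_fderiv.continuousOn
  obtain ⟨B, hB⟩ := (isCompact_closedBall (0 : E2) 1).exists_bound_of_continuousOn
    (continuous_lap h.contDiff).continuousOn
  have h0 : (0 : E2) ∈ closedBall (0 : E2) 1 := by simp
  refine ⟨max A B, (norm_nonneg _).trans ((hA 0 h0).trans (le_max_left _ _)), fun y hy => ?_⟩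
  have hy' := ball_subset_closedBall hy
  exact ⟨(hA y hy').trans (le_max_left _ _), (hB y hy').trans (le_max_right _ _)⟩

end IsCutoff

lemma HasLineDerivAt.hasDerivAt_add_smul {f f' : E2 → ℝ} {v x : E2}
    (h : ∀ x, HasLineDerivAt ℝ f (f' x) x v) (t : ℝ) :
    HasDerivAt (fun t : ℝ => f (x + t • v)) (f' (x + t • v)) t := by
  have h1 : HasDerivAt (fun s : ℝ => f (x + t • v + s • v)) (f' (x + t • v)) (t - t) := by
    rw [sub_self]; exact h (x + t • v)
  refine (h1.comp_sub_const t t).congr_of_eventuallyEq (Eventually.of_forall fun s => ?_)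
  simp only
  congr 1
  rw [add_assoc, ← add_smul]
  simp

lemma hasLineDerivAt_integral_mul {m : Measure E2} {w : E2 → ℝ} (hw : Integrable w m)
    {k k' : E2 → E2 → ℝ} {v : E2} (hk : ∀ x y, HasLineDerivAt ℝ (fun x => k x y) (k' x y) x v)
    (hkc : ∀ x, Continuous (k x)) (hkc' : ∀ x, Continuous (k' x))
    (hkb : ∀ x, ∃ C, ∀ᵐ y ∂m, |k x y| ≤ C) {C : ℝ} (hkb' : ∀ x, ∀ᵐ y ∂m, ∀ t : ℝ, |k' (x + t • v) y| ≤ C)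
    (x : E2) :
    HasLineDerivAt ℝ (fun x => ∫ y, w y * k x y ∂m) (∫ y, w y * k' x y ∂m) x v := by
  have h := hasDerivAt_integral_of_dominated_loc_of_deriv_le (μ := m) (𝕜 := ℝ)
    (F := fun t y => w y * k (x + t • v) y) (F' := fun t y => w y * k' (x + t • v) y)
    (x₀ := 0) (s := univ) (bound := fun y => |w y| * C) univ_mem
    (Eventually.of_forall fun t => hw.aestronglyMeasurable.mul (hkc _).aestronglyMeasurable)
    ?_ (hw.aestronglyMeasurable.mul (hkc' _).aestronglyMeasurable) ?_ (hw.abs.mul_const C)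
    (Eventually.of_forall fun y t _ =>
      (HasLineDerivAt.hasDerivAt_add_smul (fun x => hk x y) t).const_mul (w y))
  · simpa [HasLineDerivAt] using h.2
  · obtain ⟨C', hC'⟩ := hkb (x + (0 : ℝ) • v)
    exact hw.mul_bdd (hkc _).aestronglyMeasurable hC'
  · filter_upwards [hkb' x] with y hy t _
    rw [norm_mul, Real.norm_eq_abs, Real.norm_eq_abs]
    gcongr
    exact hy t

lemma continuous_integral_mul {m : Measure E2} {w : E2 → ℝ} (hw : Integrable w m)
    {k : E2 → E2 → ℝ} (hkc : ∀ x, Continuous (k x)) (hkc' : ∀ y, Continuous fun x => k x y)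
    {C : ℝ} (hkb : ∀ x, ∀ᵐ y ∂m, |k x y| ≤ C) :
    Continuous fun x => ∫ y, w y * k x y ∂m := by
  refine continuous_of_dominated (bound := fun y => |w y| * C)
    (fun x => hw.aestronglyMeasurable.mul (hkc x).aestronglyMeasurable) (fun x => ?_)
    (hw.abs.mul_const C) (Eventually.of_forall fun y => continuous_const.mul (hkc' y))
  filter_upwards [hkb x] with y hy
  rw [norm_mul, Real.norm_eq_abs, Real.norm_eq_abs]
  gcongr

instance (μ : SignedMeasure E2) : IsFiniteMeasure (tv μ) := by
  unfold tv SignedMeasure.totalVariation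
  infer_instance

section SignedIntegral

variable {μ : SignedMeasure E2}

lemma tv_restrict (μ : SignedMeasure E2) (s : Set E2) :
    (tv μ).restrict s = μ.toJordanDecomposition.posPart.restrict s +
      μ.toJordanDecomposition.negPart.restrict s := by
  rw [tv, SignedMeasure.totalVariation, Measure.restrict_add]

lemma sInt_eq_restrict {f : E2 → ℝ} {s : Set E2} (hf : ∀ y ∉ s, f y = 0) :
    sInt μ f = (∫ y in s, f y ∂μ.toJordanDecomposition.posPart)
      - ∫ y in s, f y ∂μ.toJordanDecomposition.negPart := by
  rw [sInt, setIntegral_eq_integral_of_forall_compl_eq_zero hf,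
    setIntegral_eq_integral_of_forall_compl_eq_zero hf]

lemma abs_sInt_le {f g : E2 → ℝ} {s : Set E2} (hf : ∀ y ∉ s, f y = 0)
    (hg : Integrable g ((tv μ).restrict s)) (h : ∀ᵐ y ∂(tv μ).restrict s, |f y| ≤ g y) :
    |sInt μ f| ≤ ∫ y in s, g y ∂tv μ := by
  rw [tv_restrict] at hg h ⊢
  rw [ae_add_measure_iff] at h
  rw [sInt_eq_restrict hf, integral_add_measure hg.left_of_add_measure hg.right_of_add_measure]
  refine (abs_sub _ _).trans (add_le_add ?_ ?_)
  · exact norm_integral_le_of_norm_le (f := f) hg.left_of_add_measure h.1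
  · exact norm_integral_le_of_norm_le (f := f) hg.right_of_add_measure h.2

lemma tendsto_sInt {F : ℕ → E2 → ℝ} {f g : E2 → ℝ} {s : Set E2} (hF : ∀ n, ∀ y ∉ s, F n y = 0)
    (hf : ∀ y ∉ s, f y = 0) (hFc : ∀ n, Continuous (F n))
    (hg : Integrable g ((tv μ).restrict s)) (h : ∀ n, ∀ᵐ y ∂(tv μ).restrict s, |F n y| ≤ g y)
    (hlim : ∀ᵐ y ∂(tv μ).restrict s, Tendsto (fun n => F n y) atTop (𝓝 (f y))) :
    Tendsto (fun n => sInt μ (F n)) atTop (𝓝 (sInt μ f)) := by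
  rw [tv_restrict] at hg hlim
  simp only [tv_restrict, ae_add_measure_iff] at h
  rw [ae_add_measure_iff] at hlim
  simp only [sInt_eq_restrict hf, sInt_eq_restrict (hF _)]
  exact (tendsto_integral_of_dominated_convergence g (fun n => (hFc n).aestronglyMeasurable)
      hg.left_of_add_measure (fun n => (h n).1) hlim.1).sub
    (tendsto_integral_of_dominated_convergence g (fun n => (hFc n).aestronglyMeasurable)
      hg.right_of_add_measure (fun n => (h n).2) hlim.2)

end SignedIntegral

lemma continuous_crossKer {η : E2 → ℝ} (hη : ContDiff ℝ (⊤ : ℕ∞) η) {e : ℝ} (he : 0 < e)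
    (x : E2) : Continuous (crossKer η e x) := by
  have h1 : Continuous (fderiv ℝ η) := hη.continuous_fderiv (by simp)
  have h2 := continuous_lap hη
  have h3 := continuous_regLog he
  have h4 := continuous_regGrad he
  unfold crossKer
  fun_prop

lemma continuous_crossKerDeriv {η : E2 → ℝ} (hη : ContDiff ℝ (⊤ : ℕ∞) η) {e : ℝ} (he : 0 < e)
    (v x : E2) : Continuous (crossKerDeriv η e v x) := by
  have h1 : Continuous (fderiv ℝ η) := hη.continuous_fderiv (by simp)
  have h2 := continuous_lap hη
  have h3 := (continuous_regHess he v).comp (continuous_id.sub (continuous_const (y := x)))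
  have h4 := continuous_regGrad he
  simp only [Function.comp_def] at h3
  unfold crossKerDeriv
  fun_prop

lemma continuous_crossKerDeriv_left (η : E2 → ℝ) {e : ℝ} (he : 0 < e)
    (v y : E2) : Continuous fun x => crossKerDeriv η e v x y := by
  have h3 := (continuous_regHess he v).comp ((continuous_const (y := y)).sub continuous_id)
  have h4 := continuous_regGrad he
  simp only [Function.comp_def] at h3
  unfold crossKerDeriv
  fun_prop

lemma abs_crossKerDeriv_le {η : E2 → ℝ} {e m G K : ℝ} {v x y : E2} (he : 0 ≤ e) (hm : 0 < m)
    (h : m ≤ ‖y - x‖ ^ 2 + e) (hG : ‖regGrad e (y - x)‖ ≤ G)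
    (h1 : ‖fderiv ℝ η y‖ ≤ K) (h2 : |lap η y| ≤ K) :
    |crossKerDeriv η e v x y| ≤ 2 * (K * (2 / m * ‖v‖)) + G * ‖v‖ * K := by
  have hG0 := (norm_nonneg _).trans hG
  have hK0 := (norm_nonneg _).trans h1
  rw [crossKerDeriv, abs_neg]
  refine (abs_add_le _ _).trans (add_le_add ?_ ?_)
  · rw [abs_mul, abs_two]
    have := (fderiv ℝ η y).le_opNorm (regHess e (y - x) v)
    rw [Real.norm_eq_abs] at this
    refine mul_le_mul_of_nonneg_left (this.trans ?_) zero_le_two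
    exact mul_le_mul h1 (norm_regHess_le hm h he v) (norm_nonneg _) hK0
  · rw [abs_mul]
    refine mul_le_mul ((abs_real_inner_le_norm _ _).trans ?_) h2 (abs_nonneg _) (by positivity)
    gcongr

namespace IsCutoff

variable {ρ d : ℝ} {η : E2 → ℝ}

lemma le_norm_sub {x y : E2} (hx : x ∈ ball (0 : E2) ρ) (hy : ρ + d ≤ ‖y‖) : d ≤ ‖y - x‖ := by
  have : ‖x‖ < ρ := by simpa using hx
  linarith [norm_sub_norm_le y x]

lemma exists_abs_crossKer_le (h : IsCutoff ρ d η) (hd : 0 < d) (hρ : ρ < 1) :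
    ∃ C, 0 ≤ C ∧ ∀ e, 0 ≤ e → e ≤ 1 → ∀ x ∈ ball (0 : E2) ρ, ∀ y ∈ ball (0 : E2) 1,
      |crossKer η e x y| ≤ C ∧ ∀ i, |crossKerDeriv η e (dir i) x y| ≤ C := by
  obtain ⟨K, hK0, hK⟩ := h.exists_bound
  set C1 := 2 * (K * d⁻¹) + 8 * d⁻¹ * K
  set C2 := 2 * (K * (2 / d ^ 2 * 1)) + d⁻¹ * 1 * K
  have hC1 : 0 ≤ C1 := by positivity
  have hC2 : 0 ≤ C2 := by positivity
  refine ⟨max C1 C2, le_max_of_le_left hC1, fun e he he1 x hx y hy => ?_⟩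
  rcases lt_or_ge ‖y‖ (ρ + d) with hyd | hyd
  · simp [crossKer, crossKerDeriv, h.fderiv_eq_zero y hyd, h.lap_eq_zero y hyd, hC1]
  have hdz := le_norm_sub hx hyd
  have hz : 0 < ‖y - x‖ := hd.trans_le hdz
  have hg : gradKer (y - x) ≤ d⁻¹ := by
    rw [gradKer]
    have h1 : 1 / (2 * Real.pi) ≤ 1 := by
      rw [div_le_one (by positivity)]; linarith [Real.pi_gt_three]
    calc _ ≤ 1 * ‖y - x‖⁻¹ := by gcongr
      _ ≤ _ := by rw [one_mul]; gcongr
  have hG : ‖regGrad e (y - x)‖ ≤ d⁻¹ := (norm_regGrad_le he _).trans hg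
  obtain ⟨h1, h2⟩ := hK y hy
  constructor
  · refine le_trans ?_ (le_max_left _ _)
    rw [crossKer]
    refine (abs_add_le _ _).trans (add_le_add ?_ ?_)
    · rw [abs_mul, abs_two]
      have := (fderiv ℝ η y).le_opNorm (regGrad e (y - x))
      rw [Real.norm_eq_abs] at this
      refine mul_le_mul_of_nonneg_left (this.trans ?_) zero_le_two
      exact mul_le_mul h1 hG (norm_nonneg _) hK0
    · rw [abs_mul]
      refine mul_le_mul ?_ h2 (abs_nonneg _) (by positivity)
      have hx1 : x ∈ ball (0 : E2) 1 := ball_subset_ball hρ.le hx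
      exact (abs_regLog_le he he1 hz (norm_sub_lt_two hx1 hy)).trans
        ((logKer_le_gradKer _).trans (by gcongr))
  · intro i
    refine le_trans ?_ (le_max_right _ _)
    have := abs_crossKerDeriv_le (v := dir i) he (by positivity : 0 < d ^ 2)
      (by nlinarith : d ^ 2 ≤ ‖y - x‖ ^ 2 + e) hG h1 h2
    rwa [norm_dir] at this

lemma tendsto_crossKer (h : IsCutoff ρ d η) (hd : 0 < d) {x : E2} (hx : x ∈ ball (0 : E2) ρ)
    (y : E2) : Tendsto (fun n => crossKer η (eps n) x y) atTop (𝓝 (crossKer η 0 x y)) := by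
  rcases lt_or_ge ‖y‖ (ρ + d) with hyd | hyd
  · simp [crossKer, h.fderiv_eq_zero y hyd, h.lap_eq_zero y hyd]
  have hz : y - x ≠ 0 := norm_pos_iff.1 (hd.trans_le (le_norm_sub hx hyd))
  exact ((((fderiv ℝ η y).continuous.tendsto _).comp (tendsto_regGrad tendsto_eps hz)).const_mul
    2).add ((tendsto_regLog tendsto_eps hz).mul_const _)

lemma tendsto_crossKerDeriv (h : IsCutoff ρ d η) (hd : 0 < d) {x : E2}
    (hx : x ∈ ball (0 : E2) ρ) (v y : E2) :
    Tendsto (fun n => crossKerDeriv η (eps n) v x y) atTop (𝓝 (crossKerDeriv η 0 v x y)) := by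
  rcases lt_or_ge ‖y‖ (ρ + d) with hyd | hyd
  · simp [crossKerDeriv, h.fderiv_eq_zero y hyd, h.lap_eq_zero y hyd]
  have hz : y - x ≠ 0 := norm_pos_iff.1 (hd.trans_le (le_norm_sub hx hyd))
  exact (((((fderiv ℝ η y).continuous.tendsto _).comp
    (tendsto_regHess tendsto_eps hz v)).const_mul 2).add
    (((tendsto_regGrad tendsto_eps hz).inner tendsto_const_nhds).mul_const _)).neg

/-- Representation of the mollified solution. -/
lemma mollification_eq (h : IsCutoff ρ d η) {μ : SignedMeasure E2} {u : E2 → ℝ}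
    (hu : IntegrableOn u (ball (0 : E2) 1) volume) (hw : WeakPoisson (ball (0 : E2) 1) u μ)
    {e : ℝ} (he : 0 < e) (x : E2) :
    ∫ y in ball (0 : E2) 1, u y * (η y * regDelta e (y - x)) =
      -sInt μ (fun y => η y * regLog e (y - x)) -
        ∫ y in ball (0 : E2) 1, u y * crossKer η e x y := by
  have hL : ContDiff ℝ (⊤ : ℕ∞) fun y => regLog e (y - x) :=
    (contDiff_regLog he).comp (contDiff_id.sub contDiff_const)
  have h1 := hw (fun y => η y * regLog e (y - x))
    ⟨h.contDiff.mul hL, h.hasCompactSupport.mul_right⟩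
    ((tsupport_mul_subset_left).trans h.tsupport_subset)
  simp only [lap_mul_regLog h.contDiff he, mul_add] at h1
  rw [integral_add] at h1
  · linarith
  · refine hu.mul_bdd (c := 1 * (1 / (Real.pi * e)))
      ((h.contDiff.continuous.mul ((continuous_regDelta he).comp
      (continuous_id.sub continuous_const))).aestronglyMeasurable)
      (Eventually.of_forall fun y => ?_)
    rw [norm_mul, Real.norm_of_nonneg (h.nonneg y),
      Real.norm_of_nonneg (regDelta_nonneg he.le _)]
    exact mul_le_mul (h.le_one y) (regDelta_le he _) (regDelta_nonneg he.le _) zero_le_one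
  · obtain ⟨C, hC⟩ := (isCompact_closedBall (0 : E2) 1).exists_bound_of_continuousOn
      (continuous_crossKer h.contDiff he x).continuousOn
    refine hu.mul_bdd (c := C) (continuous_crossKer h.contDiff he x).aestronglyMeasurable ?_
    filter_upwards [ae_restrict_mem measurableSet_ball] with y hy
    exact hC y (ball_subset_closedBall hy)

lemma exists_abs_mul_regLog_le (h : IsCutoff ρ d η) {e : ℝ} (he : 0 < e) (x : E2) :
    ∃ C, ∀ y, |η y * regLog e (y - x)| ≤ C :=
  HasCompactSupport.exists_bound_of_continuous (f := fun y => η y * regLog e (y - x))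
    h.hasCompactSupport.mul_right
    (h.contDiff.continuous.mul ((continuous_regLog he).comp (continuous_id.sub continuous_const)))

lemma continuous_mul_regLog (h : IsCutoff ρ d η) {e : ℝ} (he : 0 < e) (x : E2) :
    Continuous fun y => η y * regLog e (y - x) :=
  h.contDiff.continuous.mul ((continuous_regLog he).comp (continuous_id.sub continuous_const))

lemma continuous_mul_regGrad (h : IsCutoff ρ d η) {e : ℝ} (he : 0 < e) (v x : E2) :
    Continuous fun y => -(η y * inner ℝ (regGrad e (y - x)) v) := by
  have h1 := h.contDiff.continuous
  have h4 := continuous_regGrad he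
  fun_prop

lemma abs_mul_regGrad_le (h : IsCutoff ρ d η) {e G : ℝ} {v x y : E2}
    (hG : ‖regGrad e (y - x)‖ ≤ G) :
    |-(η y * inner ℝ (regGrad e (y - x)) v)| ≤ G * ‖v‖ := by
  rw [abs_neg, abs_mul, abs_of_nonneg (h.nonneg y)]
  calc _ ≤ 1 * |inner ℝ (regGrad e (y - x)) v| := by gcongr; exact h.le_one y
    _ ≤ ‖regGrad e (y - x)‖ * ‖v‖ := by rw [one_mul]; exact abs_real_inner_le_norm _ _
    _ ≤ _ := by gcongr

lemma hasLineDerivAt_sInt (h : IsCutoff ρ d η) (μ : SignedMeasure E2) {e : ℝ} (he : 0 < e)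
    (v x : E2) :
    HasLineDerivAt ℝ (fun x => sInt μ (fun y => η y * regLog e (y - x)))
      (sInt μ (fun y => -(η y * inner ℝ (regGrad e (y - x)) v))) x v := by
  have key : ∀ m : Measure E2, IsFiniteMeasure m →
      HasLineDerivAt ℝ (fun x => ∫ y, η y * regLog e (y - x) ∂m)
        (∫ y, -(η y * inner ℝ (regGrad e (y - x)) v) ∂m) x v := by
    intro m hm
    have := hasLineDerivAt_integral_mul (m := m) (w := fun _ => 1) (integrable_const _)
      (k := fun x y => η y * regLog e (y - x))
      (k' := fun x y => -(η y * inner ℝ (regGrad e (y - x)) v)) (v := v)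
      (fun x y => HasDerivAt.congr_deriv
        (HasDerivAt.const_mul (η y) (hasLineDerivAt_regLog_sub he v x y)) (by ring))
      (fun x => h.continuous_mul_regLog he x) (fun x => h.continuous_mul_regGrad he v x)
      (fun x => (h.exists_abs_mul_regLog_le he x).imp fun C hC => Eventually.of_forall hC)
      (C := (1 + 1 / e) * ‖v‖)
      (fun x => Eventually.of_forall fun y t =>
        h.abs_mul_regGrad_le (norm_regGrad_le_of_pos he _)) x
    simpa using this
  exact HasDerivAt.sub (key _ inferInstance) (key _ inferInstance)

lemma continuous_sInt_grad (h : IsCutoff ρ d η) (μ : SignedMeasure E2) {e : ℝ} (he : 0 < e)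
    (v : E2) : Continuous fun x => sInt μ (fun y => -(η y * inner ℝ (regGrad e (y - x)) v)) := by
  have key : ∀ m : Measure E2, IsFiniteMeasure m →
      Continuous fun x => ∫ y, -(η y * inner ℝ (regGrad e (y - x)) v) ∂m := by
    intro m hm
    have := continuous_integral_mul (m := m) (w := fun _ => 1) (integrable_const _)
      (k := fun x y => -(η y * inner ℝ (regGrad e (y - x)) v))
      (fun x => h.continuous_mul_regGrad he v x)
      (fun y => by have h4 := continuous_regGrad he; fun_prop)
      (C := (1 + 1 / e) * ‖v‖)
      (fun x => Eventually.of_forall fun y =>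
        h.abs_mul_regGrad_le (norm_regGrad_le_of_pos he _))
    simpa using this
  exact (key _ inferInstance).sub (key _ inferInstance)

lemma exists_abs_crossKerDeriv_le_of_pos (h : IsCutoff ρ d η) {e : ℝ} (he : 0 < e) (v : E2) :
    ∃ C, ∀ x, ∀ y ∈ ball (0 : E2) 1, |crossKerDeriv η e v x y| ≤ C := by
  obtain ⟨K, hK0, hK⟩ := h.exists_bound
  exact ⟨_, fun x y hy => abs_crossKerDeriv_le he.le he (by nlinarith [sq_nonneg ‖y - x‖])
    (norm_regGrad_le_of_pos he _) (hK y hy).1 (hK y hy).2⟩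

lemma hasLineDerivAt_crossInt (h : IsCutoff ρ d η) {u : E2 → ℝ}
    (hu : IntegrableOn u (ball (0 : E2) 1) volume) {e : ℝ} (he : 0 < e) (v x : E2) :
    HasLineDerivAt ℝ (fun x => ∫ y in ball (0 : E2) 1, u y * crossKer η e x y)
      (∫ y in ball (0 : E2) 1, u y * crossKerDeriv η e v x y) x v := by
  obtain ⟨C, hC⟩ := h.exists_abs_crossKerDeriv_le_of_pos he v
  refine hasLineDerivAt_integral_mul hu (fun x y => hasLineDerivAt_crossKer η he v x y)
    (continuous_crossKer h.contDiff he) (continuous_crossKerDeriv h.contDiff he v) (fun x => ?_)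
    (C := C) (fun x => ?_) x
  · obtain ⟨C', hC'⟩ := (isCompact_closedBall (0 : E2) 1).exists_bound_of_continuousOn
      (continuous_crossKer h.contDiff he x).continuousOn
    refine ⟨C', ?_⟩
    filter_upwards [ae_restrict_mem measurableSet_ball] with y hy
    exact hC' y (ball_subset_closedBall hy)
  · filter_upwards [ae_restrict_mem measurableSet_ball] with y hy t
    exact hC _ y hy

lemma continuous_crossInt (h : IsCutoff ρ d η) {u : E2 → ℝ}
    (hu : IntegrableOn u (ball (0 : E2) 1) volume) {e : ℝ} (he : 0 < e) (v : E2) :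
    Continuous fun x => ∫ y in ball (0 : E2) 1, u y * crossKerDeriv η e v x y := by
  obtain ⟨C, hC⟩ := h.exists_abs_crossKerDeriv_le_of_pos he v
  refine continuous_integral_mul hu (continuous_crossKerDeriv h.contDiff he v)
    (continuous_crossKerDeriv_left η he v) (C := C) (fun x => ?_)
  filter_upwards [ae_restrict_mem measurableSet_ball] with y hy
  exact hC x y hy

lemma continuous_mollification (h : IsCutoff ρ d η) {u : E2 → ℝ}
    (hu : IntegrableOn u (ball (0 : E2) 1) volume) {e : ℝ} (he : 0 < e) :
    Continuous fun x => ∫ y in ball (0 : E2) 1, u y * (η y * regDelta e (y - x)) := by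
  have h1 := h.contDiff.continuous
  have h2 := continuous_regDelta he
  refine continuous_integral_mul hu (k := fun x y => η y * regDelta e (y - x))
    (fun x => by fun_prop) (fun y => by fun_prop)
    (C := 1 * (1 / (Real.pi * e))) (fun x => Eventually.of_forall fun y => ?_)
  rw [abs_mul, abs_of_nonneg (h.nonneg y), abs_of_nonneg (regDelta_nonneg he.le _)]
  exact mul_le_mul (h.le_one y) (regDelta_le he _) (regDelta_nonneg he.le _) zero_le_one

end IsCutoff

lemma abs_integral_mul_le {u k : E2 → ℝ} {C : ℝ} {s : Set E2} (hs : MeasurableSet s)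
    (hu : IntegrableOn u s volume) (hk : ∀ y ∈ s, |k y| ≤ C) :
    |∫ y in s, u y * k y| ≤ C * ∫ y in s, |u y| := by
  rw [← integral_const_mul]
  rw [← Real.norm_eq_abs]
  refine norm_integral_le_of_norm_le (hu.abs.const_mul C) ?_
  filter_upwards [ae_restrict_mem hs] with y hy
  rw [norm_mul, mul_comm, Real.norm_eq_abs, Real.norm_eq_abs]
  gcongr
  exact hk y hy

lemma tendsto_integral_mul_of_bdd {u : E2 → ℝ} {k : ℕ → E2 → ℝ} {k' : E2 → ℝ} {C : ℝ}
    {s : Set E2} (hs : MeasurableSet s) (hu : IntegrableOn u s volume)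
    (hc : ∀ n, Continuous (k n)) (hk : ∀ n, ∀ y ∈ s, |k n y| ≤ C)
    (hlim : ∀ y, Tendsto (fun n => k n y) atTop (𝓝 (k' y))) :
    Tendsto (fun n => ∫ y in s, u y * k n y) atTop (𝓝 (∫ y in s, u y * k' y)) := by
  refine tendsto_integral_of_dominated_convergence (fun y => |u y| * C)
    (fun n => hu.1.mul (hc n).aestronglyMeasurable) (hu.abs.mul_const C) (fun n => ?_)
    (Eventually.of_forall fun y => (hlim y).const_mul _)
  filter_upwards [ae_restrict_mem hs] with y hy
  rw [norm_mul, Real.norm_eq_abs, Real.norm_eq_abs]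
  gcongr
  exact hk n y hy

namespace IsCutoff

variable {ρ d : ℝ} {η : E2 → ℝ}

lemma sInt_regLog (h : IsCutoff ρ d η) (μ : SignedMeasure E2) {x : E2}
    (hx : x ∈ ball (0 : E2) 1) (hne : ∀ᵐ y ∂(tv μ).restrict (ball 0 1), y ≠ x)
    (hL : Integrable (fun y => logKer (y - x)) ((tv μ).restrict (ball 0 1))) :
    (∀ n, |sInt μ (fun y => η y * regLog (eps n) (y - x))| ≤
      logPot ((tv μ).restrict (ball 0 1)) x) ∧
    Tendsto (fun n => sInt μ (fun y => η y * regLog (eps n) (y - x))) atTop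
      (𝓝 (sInt μ fun y => η y * regLog 0 (y - x))) := by
  have hb : ∀ n, ∀ᵐ y ∂(tv μ).restrict (ball 0 1),
      |η y * regLog (eps n) (y - x)| ≤ logKer (y - x) := fun n => by
    filter_upwards [hne, ae_restrict_mem measurableSet_ball] with y hy hyB
    rw [abs_mul, abs_of_nonneg (h.nonneg y), ← one_mul (logKer _)]
    exact mul_le_mul (h.le_one y) (abs_regLog_le (eps_pos n).le (eps_le_one n)
      (norm_pos_iff.2 (sub_ne_zero.2 hy)) (norm_sub_lt_two hx hyB)) (abs_nonneg _) zero_le_one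
  have h0 : ∀ e, ∀ y ∉ ball (0 : E2) 1, η y * regLog e (y - x) = 0 := fun e y hy => by
    rw [h.eq_zero hy, zero_mul]
  refine ⟨fun n => abs_sInt_le (h0 _) hL (hb n), tendsto_sInt (fun n => h0 _) (h0 0)
    (fun n => h.continuous_mul_regLog (eps_pos n) x) hL hb ?_⟩
  filter_upwards [hne] with y hy
  exact (tendsto_regLog tendsto_eps (sub_ne_zero.2 hy)).const_mul _

lemma sInt_regGrad (h : IsCutoff ρ d η) (μ : SignedMeasure E2) {x : E2}
    (hne : ∀ᵐ y ∂(tv μ).restrict (ball 0 1), y ≠ x)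
    (hL : Integrable (fun y => gradKer (y - x)) ((tv μ).restrict (ball 0 1))) (i : Fin 2) :
    (∀ n, |sInt μ (fun y => -(η y * inner ℝ (regGrad (eps n) (y - x)) (dir i)))| ≤
      gradPot ((tv μ).restrict (ball 0 1)) x) ∧
    Tendsto (fun n => sInt μ (fun y => -(η y * inner ℝ (regGrad (eps n) (y - x)) (dir i)))) atTop
      (𝓝 (sInt μ fun y => -(η y * inner ℝ (regGrad 0 (y - x)) (dir i)))) := by
  have hb : ∀ n, ∀ᵐ y ∂(tv μ).restrict (ball 0 1),
      |-(η y * inner ℝ (regGrad (eps n) (y - x)) (dir i))| ≤ gradKer (y - x) := fun n => by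
    refine Eventually.of_forall fun y => ?_
    simpa using h.abs_mul_regGrad_le (v := dir i) (norm_regGrad_le (eps_pos n).le (y - x))
  have h0 : ∀ e, ∀ y ∉ ball (0 : E2) 1, -(η y * inner ℝ (regGrad e (y - x)) (dir i)) = 0 :=
    fun e y hy => by rw [h.eq_zero hy, zero_mul, neg_zero]
  refine ⟨fun n => abs_sInt_le (h0 _) hL (hb n), tendsto_sInt (fun n => h0 _) (h0 0)
    (fun n => h.continuous_mul_regGrad (eps_pos n) _ x) hL hb ?_⟩
  filter_upwards [hne] with y hy
  exact (((tendsto_regGrad tendsto_eps (sub_ne_zero.2 hy)).inner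
    tendsto_const_nhds).const_mul _).neg

end IsCutoff

lemma ae_eq_of_tendsto_integral {ρ : ℝ} {U : ℕ → E2 → ℝ} {u w g : E2 → ℝ}
    (hU : ∀ n, Continuous (U n)) (hu : IntegrableOn u (ball 0 ρ) volume)
    (hg : IntegrableOn g (ball 0 ρ) volume)
    (hb : ∀ᵐ x ∂volume.restrict (ball (0 : E2) ρ), ∀ n, |U n x| ≤ g x)
    (hlim : ∀ᵐ x ∂volume.restrict (ball (0 : E2) ρ), Tendsto (fun n => U n x) atTop (𝓝 (w x)))
    (hw : ∀ φ : E2 → ℝ, Continuous φ → HasCompactSupport φ → tsupport φ ⊆ ball 0 ρ →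
      Tendsto (fun n => ∫ x, φ x * U n x) atTop (𝓝 (∫ x in ball 0 ρ, φ x * u x))) :
    ∀ᵐ x ∂volume.restrict (ball (0 : E2) ρ), w x = u x := by
  have hwm : AEStronglyMeasurable w (volume.restrict (ball (0 : E2) ρ)) :=
    aestronglyMeasurable_of_tendsto_ae atTop (fun n => (hU n).aestronglyMeasurable) hlim
  have hwi : IntegrableOn w (ball 0 ρ) volume := by
    refine Integrable.mono' hg hwm ?_
    filter_upwards [hb, hlim] with x hx hxl
    exact le_of_tendsto hxl.abs (Eventually.of_forall hx)
  have key := isOpen_ball.ae_eq_zero_of_integral_contDiff_smul_eq_zero (μ := volume)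
    (U := ball (0 : E2) ρ) (f := fun x => w x - u x) (hwi.sub hu).locallyIntegrableOn ?_
  · rw [ae_restrict_iff' measurableSet_ball]
    filter_upwards [key] with x hx hxB
    exact sub_eq_zero.1 (hx hxB)
  intro φ hφ hc hs
  have hz : ∀ x ∉ ball (0 : E2) ρ, φ x = 0 := fun x hx =>
    image_eq_zero_of_notMem_tsupport fun hx' => hx (hs hx')
  obtain ⟨K, hK⟩ := hφ.continuous.bounded_above_of_compact_support hc
  have hfi : ∀ f : E2 → ℝ, IntegrableOn f (ball 0 ρ) volume →
      Integrable (fun x => φ x * f x) (volume.restrict (ball 0 ρ)) := fun f hf =>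
    hf.bdd_mul (c := K) hφ.continuous.aestronglyMeasurable (Eventually.of_forall hK)
  have h1 := hw φ hφ.continuous hc hs
  have h2 : Tendsto (fun n => ∫ x, φ x * U n x) atTop (𝓝 (∫ x in ball 0 ρ, φ x * w x)) := by
    have : ∀ n, ∫ x, φ x * U n x = ∫ x in ball 0 ρ, φ x * U n x := fun n =>
      (setIntegral_eq_integral_of_forall_compl_eq_zero fun x hx => by rw [hz x hx, zero_mul]).symm
    simp only [this]
    refine tendsto_integral_of_dominated_convergence (fun x => K * g x)
      (fun n => (hφ.continuous.mul (hU n)).aestronglyMeasurable) (hg.const_mul K) (fun n => ?_)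
      (hlim.mono fun x hx => hx.const_mul _)
    filter_upwards [hb] with x hx
    rw [norm_mul]
    exact mul_le_mul (hK x) (hx n) (norm_nonneg _) ((norm_nonneg _).trans (hK x))
  have h3 := tendsto_nhds_unique h1 h2
  rw [← setIntegral_eq_integral_of_forall_compl_eq_zero (s := ball 0 ρ)
    fun x hx => by rw [hz x hx, zero_smul]]
  simp only [smul_eq_mul, mul_sub]
  rw [integral_sub (hfi w hwi) (hfi u hu), h3, sub_self]

lemma integrableOn_gradPot (ν : Measure E2) [IsFiniteMeasure ν]
    (hν : ∀ᵐ y ∂ν, y ∈ ball (0 : E2) 1) : IntegrableOn (gradPot ν) (ball 0 1) volume := by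
  obtain ⟨C, hC, h⟩ := exists_lintegral_gradPot_rpow_le (s := 1) (τ := ν.real univ + 1) le_rfl
    one_lt_two (by positivity)
  have := h ν hν (by linarith)
  simp only [Real.rpow_one] at this
  refine ⟨(stronglyMeasurable_gradPot ν).aestronglyMeasurable, ?_⟩
  rw [hasFiniteIntegral_iff_ofReal (Eventually.of_forall (gradPot_nonneg ν))]
  exact this.trans_lt hC.lt_top

lemma logPot_le_gradPot {ν : Measure E2} {x : E2} (h1 : Integrable (fun y => logKer (y - x)) ν)
    (h2 : Integrable (fun y => gradKer (y - x)) ν) : logPot ν x ≤ 8 * gradPot ν x := by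
  rw [logPot, gradPot, ← integral_const_mul]
  exact integral_mono h1 (h2.const_mul 8) fun y => logKer_le_gradKer _

/-- Smooth approximation of a solution of `-Δu = μ` and of its gradient, with pointwise control by
the logarithmic potential of `|μ|` and its gradient. -/
lemma exists_approx {ρ : ℝ} (h0 : 0 < ρ) (h1 : ρ < 1) :
    ∃ C : ℝ, 0 ≤ C ∧ ∀ (μ : SignedMeasure E2) (u : E2 → ℝ),
      IntegrableOn u (ball (0 : E2) 1) volume → WeakPoisson (ball (0 : E2) 1) u μ →
      ∃ (U : ℕ → E2 → ℝ) (dU : ℕ → Fin 2 → E2 → ℝ) (dw : Fin 2 → E2 → ℝ),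
        (∀ n, Continuous (U n)) ∧ (∀ n i, Continuous (dU n i)) ∧
        (∀ n i x, HasLineDerivAt ℝ (U n) (dU n i x) x (dir i)) ∧
        ∀ᵐ x ∂volume.restrict (ball (0 : E2) ρ),
          Tendsto (fun n => U n x) atTop (𝓝 (u x)) ∧
          (∀ i, Tendsto (fun n => dU n i x) atTop (𝓝 (dw i x))) ∧
          (∀ n, |U n x| ≤ logPot ((tv μ).restrict (ball 0 1)) x +
            C * ∫ y in ball (0 : E2) 1, |u y|) ∧
          ∀ n i, |dU n i x| ≤ gradPot ((tv μ).restrict (ball 0 1)) x +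
            C * ∫ y in ball (0 : E2) 1, |u y| := by
  obtain ⟨d, hd, η, h⟩ := exists_isCutoff h0 h1
  obtain ⟨C, hC0, hC⟩ := h.exists_abs_crossKer_le hd h1
  refine ⟨C, hC0, fun μ u hu hw => ?_⟩
  set ν := (tv μ).restrict (ball 0 1) with hνdef
  have hν : ∀ᵐ y ∂ν, y ∈ ball (0 : E2) 1 := ae_restrict_mem measurableSet_ball
  set I := ∫ y in ball (0 : E2) 1, |u y|
  set U : ℕ → E2 → ℝ := fun n x =>
    ∫ y in ball (0 : E2) 1, u y * (η y * regDelta (eps n) (y - x)) with hU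
  set dU : ℕ → Fin 2 → E2 → ℝ := fun n i x =>
    -sInt μ (fun y => -(η y * inner ℝ (regGrad (eps n) (y - x)) (dir i))) -
      ∫ y in ball (0 : E2) 1, u y * crossKerDeriv η (eps n) (dir i) x y
  set w : E2 → ℝ := fun x => -sInt μ (fun y => η y * regLog 0 (y - x)) -
      ∫ y in ball (0 : E2) 1, u y * crossKer η 0 x y
  set dw : Fin 2 → E2 → ℝ := fun i x =>
    -sInt μ (fun y => -(η y * inner ℝ (regGrad 0 (y - x)) (dir i))) -
      ∫ y in ball (0 : E2) 1, u y * crossKerDeriv η 0 (dir i) x y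
  have hUeq : ∀ n x, U n x = -sInt μ (fun y => η y * regLog (eps n) (y - x)) -
        ∫ y in ball (0 : E2) 1, u y * crossKer η (eps n) x y := fun n x =>
    h.mollification_eq hu hw (eps_pos n) x
  have hUc : ∀ n, Continuous (U n) := fun n => h.continuous_mollification hu (eps_pos n)
  have hsub : ball (0 : E2) ρ ⊆ ball 0 1 := ball_subset_ball h1.le
  have hres := Measure.restrict_mono_ae (μ := (volume : Measure E2)) hsub.eventuallyLE
  have hgood : ∀ᵐ x ∂volume.restrict (ball (0 : E2) ρ), x ∈ ball (0 : E2) ρ ∧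
      (∀ᵐ y ∂ν, y ≠ x) ∧ Integrable (fun y => logKer (y - x)) ν ∧
      Integrable (fun y => gradKer (y - x)) ν := by
    filter_upwards [ae_restrict_mem measurableSet_ball, ae_restrict_of_ae (ae_ae_ne ν),
      ae_mono hres (ae_integrable_logKer ν hν),
      ae_mono hres (ae_integrable_gradKer ν hν)] with x a b c d using ⟨a, b, c, d⟩
  have htri : ∀ {a b A B : ℝ}, |a| ≤ A → |b| ≤ B → |-a - b| ≤ A + B := fun ha hb => by
    refine (abs_sub _ _).trans ?_
    rw [abs_neg]
    exact add_le_add ha hb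
  have hmain : ∀ᵐ x ∂volume.restrict (ball (0 : E2) ρ),
      Tendsto (fun n => U n x) atTop (𝓝 (w x)) ∧
      (∀ i, Tendsto (fun n => dU n i x) atTop (𝓝 (dw i x))) ∧
      (∀ n, |U n x| ≤ logPot ν x + C * I) ∧ ∀ n i, |dU n i x| ≤ gradPot ν x + C * I := by
    filter_upwards [hgood] with x ⟨hx, hne, hL, hG⟩
    have hP := h.sInt_regLog μ (hsub hx) hne hL
    have hcb : ∀ n, ∀ y ∈ ball (0 : E2) 1, |crossKer η (eps n) x y| ≤ C ∧
        ∀ i, |crossKerDeriv η (eps n) (dir i) x y| ≤ C := fun n y hy =>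
      hC _ (eps_pos n).le (eps_le_one n) x hx y hy
    refine ⟨?_, fun i => ?_, fun n => ?_, fun n i => ?_⟩
    · simp only [hUeq]
      exact hP.2.neg.sub (tendsto_integral_mul_of_bdd measurableSet_ball hu
        (fun n => continuous_crossKer h.contDiff (eps_pos n) x) (fun n y hy => (hcb n y hy).1)
        (h.tendsto_crossKer hd hx))
    · exact (h.sInt_regGrad μ hne hG i).2.neg.sub
        (tendsto_integral_mul_of_bdd measurableSet_ball hu
          (fun n => continuous_crossKerDeriv h.contDiff (eps_pos n) _ x)
          (fun n y hy => (hcb n y hy).2 i) (h.tendsto_crossKerDeriv hd hx _))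
    · rw [hUeq]
      exact htri (hP.1 n) (abs_integral_mul_le measurableSet_ball hu fun y hy => (hcb n y hy).1)
    · exact htri ((h.sInt_regGrad μ hne hG i).1 n)
        (abs_integral_mul_le measurableSet_ball hu fun y hy => (hcb n y hy).2 i)
  have hwu : ∀ᵐ x ∂volume.restrict (ball (0 : E2) ρ), w x = u x := by
    refine ae_eq_of_tendsto_integral hUc (hu.mono_set hsub)
      (g := fun x => 8 * gradPot ν x + C * I) ?_ ?_ (hmain.mono fun x hx => hx.1) ?_
    · refine Integrable.add (((integrableOn_gradPot ν hν).mono_set hsub).const_mul 8) ?_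
      exact integrableOn_const measure_ball_lt_top.ne
    · filter_upwards [hmain, hgood] with x hx hx' n
      exact (hx.2.2.1 n).trans (by gcongr; exact logPot_le_gradPot hx'.2.2.1 hx'.2.2.2)
    · intro φ hφ hc hs
      have hz : ∀ x ∉ ball (0 : E2) ρ, φ x = 0 := fun x hx =>
        image_eq_zero_of_notMem_tsupport fun hx' => hx (hs hx')
      have hf : Integrable ((ball (0 : E2) 1).indicator fun y => u y * η y) volume := by
        rw [integrable_indicator_iff measurableSet_ball]
        refine hu.mul_bdd (c := 1) h.contDiff.continuous.aestronglyMeasurable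
          (Eventually.of_forall fun y => ?_)
        rw [Real.norm_of_nonneg (h.nonneg y)]
        exact h.le_one y
      have hconv : ∀ n x, U n x = ∫ y, (ball (0 : E2) 1).indicator (fun y => u y * η y) y *
          regDelta (eps n) (y - x) := fun n x => by
        simp only [hU]
        rw [← integral_indicator measurableSet_ball]
        refine integral_congr_ae (Eventually.of_forall fun y => ?_)
        by_cases hy : y ∈ ball (0 : E2) 1
        · simp only [indicator_of_mem hy]; ring
        · simp only [indicator_of_notMem hy, zero_mul]
      have hlimit : ∫ x in ball 0 ρ, φ x * u x =
          ∫ y, (ball (0 : E2) 1).indicator (fun y => u y * η y) y * φ y := by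
        rw [← setIntegral_eq_integral_of_forall_compl_eq_zero (s := ball 0 ρ) (f := fun y =>
          (ball (0 : E2) 1).indicator (fun y => u y * η y) y * φ y)
          (fun x hx => by rw [hz x hx, mul_zero])]
        refine setIntegral_congr_fun measurableSet_ball fun x hx => ?_
        simp only [indicator_of_mem (hsub hx), h.eq_one x hx]
        ring
      simp only [hconv, hlimit]
      exact tendsto_integral_mul_mollification hf hφ hc
  refine ⟨U, dU, dw, hUc, fun n i => ?_, fun n i x => ?_, ?_⟩
  · exact (h.continuous_sInt_grad μ (eps_pos n) _).neg.sub
      (h.continuous_crossInt hu (eps_pos n) _)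
  · have := (HasDerivAt.neg (h.hasLineDerivAt_sInt μ (eps_pos n) (dir i) x)).sub
      (h.hasLineDerivAt_crossInt hu (eps_pos n) (dir i) x)
    refine HasDerivAt.congr_of_eventuallyEq this (Eventually.of_forall fun t => ?_)
    exact hUeq n _
  · filter_upwards [hmain, hwu] with x hx hxw
    rw [← hxw]
    exact hx

lemma add_rpow_le_two_rpow_mul {a b s : ℝ} (ha : 0 ≤ a) (hb : 0 ≤ b) (hs : 0 ≤ s) :
    (a + b) ^ s ≤ 2 ^ s * (a ^ s + b ^ s) := by
  have h1 : a + b ≤ 2 * max a b := by linarith [le_max_left a b, le_max_right a b]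
  have h2 : (max a b) ^ s ≤ a ^ s + b ^ s := by
    rcases max_choice a b with h | h <;> rw [h]
    · exact le_add_of_nonneg_right (by positivity)
    · exact le_add_of_nonneg_left (by positivity)
  calc (a + b) ^ s ≤ (2 * max a b) ^ s := by gcongr
    _ = 2 ^ s * (max a b) ^ s := Real.mul_rpow zero_le_two (le_max_of_le_left ha)
    _ ≤ _ := by gcongr

/-- Pointwise majorant of the exponential of a solution and of its gradient. -/
def majorant (M : ℝ) (ν : Measure E2) (x : E2) : ℝ :=
  Real.exp (logPot ν x + M) * (gradPot ν x + (M + 1))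

lemma majorant_nonneg {M : ℝ} (hM : 0 ≤ M) (ν : Measure E2) (x : E2) : 0 ≤ majorant M ν x := by
  have := gradPot_nonneg ν x
  unfold majorant
  positivity

lemma stronglyMeasurable_majorant (M : ℝ) (ν : Measure E2) [IsFiniteMeasure ν] :
    StronglyMeasurable (majorant M ν) :=
  (Real.continuous_exp.comp_stronglyMeasurable
    ((stronglyMeasurable_logPot ν).add stronglyMeasurable_const)).mul
    ((stronglyMeasurable_gradPot ν).add stronglyMeasurable_const)

lemma exp_le_majorant {M : ℝ} (hM : 0 ≤ M) (ν : Measure E2) {x : E2} {a : ℝ}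
    (ha : |a| ≤ logPot ν x + M) : Real.exp a ≤ majorant M ν x := by
  rw [majorant, ← mul_one (Real.exp a)]
  have := gradPot_nonneg ν x
  exact mul_le_mul (Real.exp_le_exp.2 ((le_abs_self a).trans ha)) (by linarith) zero_le_one
    (Real.exp_pos _).le

lemma abs_exp_mul_le_majorant {M : ℝ} (ν : Measure E2) {x : E2} {a b : ℝ}
    (ha : |a| ≤ logPot ν x + M) (hb : |b| ≤ gradPot ν x + M) :
    |Real.exp a * b| ≤ majorant M ν x := by
  rw [majorant, abs_mul, Real.abs_exp]
  exact mul_le_mul (Real.exp_le_exp.2 ((le_abs_self a).trans ha)) (by linarith) (abs_nonneg _)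
    (Real.exp_pos _).le

lemma majorant_rpow_le {M q s : ℝ} (hM : 0 ≤ M) (hq : 1 ≤ q) (hs : q < s) (ν : Measure E2)
    (x : E2) : majorant M ν x ^ q ≤ Real.exp (q * M) * (Real.exp (q * s / (s - q) * logPot ν x) +
      2 ^ s * (gradPot ν x ^ s + (M + 1) ^ s)) := by
  have hG := gradPot_nonneg ν x
  have hsq : 0 < s - q := by linarith
  have hq0 : 0 < q := by linarith
  have hs0 : 0 < s := by linarith
  set A := logPot ν x
  set G := gradPot ν x
  have hconj : (s / (s - q)).HolderConjugate (s / q) := by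
    rw [Real.holderConjugate_iff]
    refine ⟨(one_lt_div hsq).2 (by linarith), ?_⟩
    field_simp
    ring
  have h1 := Real.young_inequality_of_nonneg (Real.exp_pos (q * A)).le
    (by positivity : 0 ≤ (G + (M + 1)) ^ q) hconj
  have h2 : Real.exp (q * A) ^ (s / (s - q)) = Real.exp (q * s / (s - q) * A) := by
    rw [← Real.exp_mul]; congr 1; ring
  have h3 : ((G + (M + 1)) ^ q) ^ (s / q) = (G + (M + 1)) ^ s := by
    rw [← Real.rpow_mul (by positivity)]; congr 1; field_simp
  rw [h2, h3] at h1
  have h4 := add_rpow_le_two_rpow_mul hG (by positivity : 0 ≤ M + 1) hs0.le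
  have h5 : majorant M ν x ^ q = Real.exp (q * M) *
      (Real.exp (q * A) * (G + (M + 1)) ^ q) := by
    rw [majorant, Real.mul_rpow (Real.exp_pos _).le (by positivity), ← Real.exp_mul, ← mul_assoc,
      ← Real.exp_add]
    congr 2; ring
  rw [h5]
  refine mul_le_mul_of_nonneg_left (h1.trans (add_le_add ?_ (le_trans ?_ h4)))
    (Real.exp_pos _).le
  · exact div_le_self (Real.exp_pos _).le hconj.lt.le
  · exact div_le_self (by positivity) ((one_le_div hq0).2 hs.le)

lemma exists_lintegral_majorant_rpow_le {q : ℝ} (hq : 1 ≤ q) (hq2 : q < 2) :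
    ∃ τ₀ : ℝ, 0 < τ₀ ∧ ∀ M : ℝ, 0 ≤ M → ∃ β : ℝ≥0∞, β ≠ ∞ ∧ ∀ (ν : Measure E2) [IsFiniteMeasure ν],
      (∀ᵐ y ∂ν, y ∈ ball (0 : E2) 1) → ν.real univ ≤ τ₀ →
      ∫⁻ x in ball (0 : E2) 1, ENNReal.ofReal (majorant M ν x ^ q) ≤ β := by
  set s := (q + 2) / 2 with hs
  have hqs : q < s := by rw [hs]; linarith
  have hs2 : s < 2 := by rw [hs]; linarith
  set p := q * s / (s - q)
  have hp : 0 < p := div_pos (by nlinarith) (by linarith)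
  have hτ : 0 < 2 * Real.pi / p := by positivity
  refine ⟨2 * Real.pi / p, hτ, fun M hM => ?_⟩
  obtain ⟨C1, hC1, H1⟩ := exists_lintegral_exp_logPot_le (τ := 2 * Real.pi / p) hp (by
    rw [mul_div_cancel₀ _ hp.ne']; linarith [Real.pi_pos])
  obtain ⟨C2, hC2, H2⟩ := exists_lintegral_gradPot_rpow_le (s := s) (by linarith) hs2 hτ
  refine ⟨ENNReal.ofReal (Real.exp (q * M)) * (C1 + ENNReal.ofReal (2 ^ s) *
    (C2 + ENNReal.ofReal ((M + 1) ^ s) * volume (ball (0 : E2) 1))), ?_, fun ν _ hν hντ => ?_⟩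
  · exact ENNReal.mul_ne_top ENNReal.ofReal_ne_top (ENNReal.add_ne_top.2 ⟨hC1,
      ENNReal.mul_ne_top ENNReal.ofReal_ne_top (ENNReal.add_ne_top.2 ⟨hC2,
        ENNReal.mul_ne_top ENNReal.ofReal_ne_top measure_ball_lt_top.ne⟩)⟩)
  have hmG : Measurable fun x => ENNReal.ofReal (gradPot ν x ^ s) :=
    ((stronglyMeasurable_gradPot ν).measurable.pow_const s).ennreal_ofReal
  have hmL : Measurable fun x => ENNReal.ofReal (Real.exp (p * logPot ν x)) :=
    (Real.measurable_exp.comp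
      ((stronglyMeasurable_logPot ν).measurable.const_mul p)).ennreal_ofReal
  calc ∫⁻ x in ball (0 : E2) 1, ENNReal.ofReal (majorant M ν x ^ q)
      ≤ ∫⁻ x in ball (0 : E2) 1, ENNReal.ofReal (Real.exp (q * M)) *
          (ENNReal.ofReal (Real.exp (p * logPot ν x)) + ENNReal.ofReal (2 ^ s) *
            (ENNReal.ofReal (gradPot ν x ^ s) + ENNReal.ofReal ((M + 1) ^ s))) := by
        refine lintegral_mono fun x => ?_
        have hG := gradPot_nonneg ν x
        rw [← ENNReal.ofReal_add (by positivity) (by positivity),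
          ← ENNReal.ofReal_mul (by positivity),
          ← ENNReal.ofReal_add (by positivity) (by positivity),
          ← ENNReal.ofReal_mul (by positivity)]
        exact ENNReal.ofReal_le_ofReal (majorant_rpow_le hM hq hqs ν x)
    _ = ENNReal.ofReal (Real.exp (q * M)) *
          ((∫⁻ x in ball (0 : E2) 1, ENNReal.ofReal (Real.exp (p * logPot ν x))) +
            ENNReal.ofReal (2 ^ s) * ((∫⁻ x in ball (0 : E2) 1, ENNReal.ofReal (gradPot ν x ^ s)) +
            ENNReal.ofReal ((M + 1) ^ s) * volume (ball (0 : E2) 1))) := by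
        rw [lintegral_const_mul' _ _ ENNReal.ofReal_ne_top, lintegral_add_left hmL,
          lintegral_const_mul' _ _ ENNReal.ofReal_ne_top, lintegral_add_left hmG,
          setLIntegral_const]
    _ ≤ _ := by
        gcongr
        · exact H1 ν hν hντ
        · exact H2 ν hν hντ

lemma integrableOn_majorant {M q : ℝ} (hM : 0 ≤ M) (hq : 1 ≤ q) (ν : Measure E2)
    [IsFiniteMeasure ν]
    (h : ∫⁻ x in ball (0 : E2) 1, ENNReal.ofReal (majorant M ν x ^ q) ≠ ∞) :
    IntegrableOn (majorant M ν) (ball 0 1) volume := by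
  have h1 : IntegrableOn (fun x => majorant M ν x ^ q) (ball 0 1) volume := by
    refine ⟨((stronglyMeasurable_majorant M ν).measurable.pow_const q).aestronglyMeasurable, ?_⟩
    rw [hasFiniteIntegral_iff_ofReal (Eventually.of_forall fun x =>
      Real.rpow_nonneg (majorant_nonneg hM ν x) q)]
    exact h.lt_top
  have h2 : IntegrableOn (fun _ : E2 => (1 : ℝ)) (ball 0 1) volume :=
    integrableOn_const measure_ball_lt_top.ne
  refine (h2.add h1).mono' (stronglyMeasurable_majorant M ν).aestronglyMeasurable
    (Eventually.of_forall fun x => ?_)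
  rw [Real.norm_of_nonneg (majorant_nonneg hM ν x), Pi.add_apply]
  rcases le_total (majorant M ν x) 1 with hx | hx
  · exact hx.trans (le_add_of_nonneg_right (Real.rpow_nonneg (majorant_nonneg hM ν x) q))
  · exact (Real.self_le_rpow_of_one_le hx hq).trans (by linarith)

lemma integral_mul_fderiv_eq_neg {V dV φ : E2 → ℝ} {v : E2} (hV : Continuous V)
    (hdV : Continuous dV) (h : ∀ x, HasLineDerivAt ℝ V (dV x) x v) (hφ : IsTest φ) :
    ∫ x, V x * fderiv ℝ φ x v = -∫ x, φ x * dV x := by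
  obtain ⟨hφs, hφc⟩ := hφ
  have hφ' : Continuous fun x => fderiv ℝ φ x v :=
    (hφs.continuous_fderiv (by simp)).clm_apply continuous_const
  have hφc' : HasCompactSupport fun x => fderiv ℝ φ x v := hφc.fderiv_apply ℝ v
  have := integral_bilinear_hasLineDerivAt_right_eq_neg_left_of_integrable (μ := volume)
    (B := ContinuousLinearMap.mul ℝ ℝ) (f := V) (f' := dV) (g := φ)
    (g' := fun x => fderiv ℝ φ x v) (v := v)
    ((hdV.mul hφs.continuous).integrable_of_hasCompactSupport hφc.mul_left)
    ((hV.mul hφ').integrable_of_hasCompactSupport hφc'.mul_left)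
    ((hV.mul hφs.continuous).integrable_of_hasCompactSupport hφc.mul_left)
    (fun x _ => h x)
    (fun x _ => ((hφs.differentiable (by simp)) x).hasFDerivAt.hasLineDerivAt v)
  simp only [ContinuousLinearMap.mul_apply'] at this
  rw [this]
  simp only [mul_comm]

lemma tendsto_setIntegral_mul {V : ℕ → E2 → ℝ} {V' φ Φ : E2 → ℝ} {s : Set E2}
    (hV : ∀ n, Continuous (V n)) (hφ : Continuous φ) (hc : HasCompactSupport φ)
    (hΦ : IntegrableOn Φ s volume)
    (h : ∀ᵐ x ∂volume.restrict s, Tendsto (fun n => V n x) atTop (𝓝 (V' x)) ∧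
      ∀ n, |V n x| ≤ Φ x) :
    Tendsto (fun n => ∫ x in s, φ x * V n x) atTop (𝓝 (∫ x in s, φ x * V' x)) := by
  obtain ⟨K, hK⟩ := hφ.bounded_above_of_compact_support hc
  refine tendsto_integral_of_dominated_convergence (fun x => K * Φ x)
    (fun n => (hφ.mul (hV n)).aestronglyMeasurable) (hΦ.const_mul K) (fun n => ?_)
    (h.mono fun x hx => hx.1.const_mul _)
  filter_upwards [h] with x hx
  rw [norm_mul]
  exact mul_le_mul (hK x) (hx.2 n) (norm_nonneg _) ((norm_nonneg _).trans (hK x))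

lemma norm_le_two_mul_of_coord {z : E2} {a : ℝ} (ha : 0 ≤ a) (h : ∀ i, |z i| ≤ a) :
    ‖z‖ ≤ 2 * a := by
  refine le_of_sq_le_sq ?_ (by positivity)
  rw [EuclideanSpace.norm_sq_eq, Fin.sum_univ_two, Real.norm_eq_abs, Real.norm_eq_abs]
  nlinarith [h 0, h 1, abs_nonneg (z 0), abs_nonneg (z 1)]

/-- A locally supported weak gradient of the exponential, from a smooth approximation. -/
lemma exists_isWeakGrad_exp {ρ : ℝ} {u Φ : E2 → ℝ} {U : ℕ → E2 → ℝ}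
    {dU : ℕ → Fin 2 → E2 → ℝ} {dw : Fin 2 → E2 → ℝ}
    (hU : ∀ n, Continuous (U n)) (hdU : ∀ n i, Continuous (dU n i))
    (hD : ∀ n i x, HasLineDerivAt ℝ (U n) (dU n i x) x (dir i))
    (hΦ : IntegrableOn Φ (ball 0 ρ) volume)
    (h : ∀ᵐ x ∂volume.restrict (ball (0 : E2) ρ), Tendsto (fun n => U n x) atTop (𝓝 (u x)) ∧
      (∀ i, Tendsto (fun n => dU n i x) atTop (𝓝 (dw i x))) ∧
      ∀ n, Real.exp (U n x) ≤ Φ x ∧ ∀ i, |Real.exp (U n x) * dU n i x| ≤ Φ x) :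
    ∃ g : E2 → E2, IsWeakGrad (ball 0 ρ) (fun x => Real.exp (u x)) g ∧
      IntegrableOn g (ball 0 ρ) volume ∧
      ∀ᵐ x ∂volume.restrict (ball (0 : E2) ρ), Real.exp (u x) ≤ Φ x ∧ ‖g x‖ ≤ 2 * Φ x := by
  have hE : ∀ n, Continuous fun x => Real.exp (U n x) := fun n => (hU n).rexp
  have hlimE : ∀ᵐ x ∂volume.restrict (ball (0 : E2) ρ),
      Tendsto (fun n => Real.exp (U n x)) atTop (𝓝 (Real.exp (u x))) :=
    h.mono fun x hx => (Real.continuous_exp.tendsto _).comp hx.1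
  have hlimG : ∀ᵐ x ∂volume.restrict (ball (0 : E2) ρ), ∀ i,
      Tendsto (fun n => Real.exp (U n x) * dU n i x) atTop (𝓝 (Real.exp (u x) * dw i x)) := by
    filter_upwards [h, hlimE] with x hx hx' i using hx'.mul (hx.2.1 i)
  set g : E2 → E2 := fun x => WithLp.toLp 2 fun i => Real.exp (u x) * dw i x with hg
  have hbd : ∀ᵐ x ∂volume.restrict (ball (0 : E2) ρ), Real.exp (u x) ≤ Φ x ∧
      ‖g x‖ ≤ 2 * Φ x := by
    filter_upwards [h, hlimE, hlimG] with x hx h1 h2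
    have hx1 : Real.exp (u x) ≤ Φ x :=
      le_of_tendsto h1 (Eventually.of_forall fun n => (hx.2.2 n).1)
    refine ⟨hx1, norm_le_two_mul_of_coord ((Real.exp_pos _).le.trans hx1) fun i => ?_⟩
    exact le_of_tendsto (h2 i).abs (Eventually.of_forall fun n => (hx.2.2 n).2 i)
  refine ⟨g, ?_, ?_, hbd⟩
  · intro φ hφ hs i
    have hφ' : Continuous fun x => fderiv ℝ φ x (dir i) :=
      (hφ.1.continuous_fderiv (by simp)).clm_apply continuous_const
    have hφc' : HasCompactSupport fun x => fderiv ℝ φ x (dir i) := hφ.2.fderiv_apply ℝ _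
    have hz : ∀ x ∉ ball (0 : E2) ρ, φ x = 0 := fun x hx =>
      image_eq_zero_of_notMem_tsupport fun hx' => hx (hs hx')
    have hz' : ∀ x ∉ ball (0 : E2) ρ, fderiv ℝ φ x (dir i) = 0 := fun x hx => by
      rw [image_eq_zero_of_notMem_tsupport fun hx' => hx (hs (tsupport_fderiv_subset ℝ hx'))]
      rfl
    have h1 := tendsto_setIntegral_mul hE hφ' hφc' hΦ
      (V' := fun x => Real.exp (u x)) (by
        filter_upwards [h, hlimE] with x hx hx'
        exact ⟨hx', fun n => by rw [Real.abs_exp]; exact (hx.2.2 n).1⟩)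
    have h2 := tendsto_setIntegral_mul (fun n => (hE n).mul (hdU n i)) hφ.1.continuous hφ.2 hΦ
      (V' := fun x => Real.exp (u x) * dw i x) (by
        filter_upwards [h, hlimG] with x hx hx'
        exact ⟨hx' i, fun n => (hx.2.2 n).2 i⟩)
    have h3 : ∀ n, ∫ x in ball (0 : E2) ρ, fderiv ℝ φ x (dir i) * Real.exp (U n x) =
        -∫ x in ball (0 : E2) ρ, φ x * (Real.exp (U n x) * dU n i x) := fun n => by
      have h4 : ∀ x, HasLineDerivAt ℝ (fun x => Real.exp (U n x)) (Real.exp (U n x) * dU n i x) x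
          (dir i) := fun x => by
        have := HasDerivAt.exp (hD n i x)
        simp only [zero_smul, add_zero] at this
        exact this
      have h5 := integral_mul_fderiv_eq_neg (dV := fun x => Real.exp (U n x) * dU n i x) (hE n) ((hE n).mul (hdU n i)) h4 hφ
      rw [setIntegral_eq_integral_of_forall_compl_eq_zero
          (fun x hx => by rw [hz' x hx, zero_mul]),
        setIntegral_eq_integral_of_forall_compl_eq_zero (fun x hx => by rw [hz x hx, zero_mul])]
      simpa only [mul_comm (Real.exp (U n _)) (fderiv ℝ φ _ _)] using h5
    simp only [h3] at h1
    have h4 := tendsto_nhds_unique h1 h2.neg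
    simp only [mul_comm (Real.exp _)]
    exact h4
  · refine Integrable.mono' (hΦ.const_mul 2) ?_ (hbd.mono fun x hx => hx.2)
    refine (PiLp.continuous_toLp 2 _).comp_aestronglyMeasurable ?_
    rw [aestronglyMeasurable_iff_aemeasurable, aemeasurable_pi_iff]
    intro i
    refine AEStronglyMeasurable.aemeasurable ?_
    exact aestronglyMeasurable_of_tendsto_ae atTop
      (fun n => ((hE n).mul (hdU n i)).aestronglyMeasurable) (hlimG.mono fun x hx => hx i)

lemma IsWeakGrad.mono {ρ ρ' : ℝ} {v : E2 → ℝ} {g : E2 → E2} (h : IsWeakGrad (ball 0 ρ') v g)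
    (hρ : ρ ≤ ρ') : IsWeakGrad (ball 0 ρ) v g := by
  intro φ hφ hs i
  have hz : ∀ x ∉ ball (0 : E2) ρ, φ x = 0 := fun x hx =>
    image_eq_zero_of_notMem_tsupport fun hx' => hx (hs hx')
  have hz' : ∀ x ∉ ball (0 : E2) ρ, fderiv ℝ φ x = 0 := fun x hx =>
    image_eq_zero_of_notMem_tsupport fun hx' => hx (hs (tsupport_fderiv_subset ℝ hx'))
  have hsub : ball (0 : E2) ρ ⊆ ball 0 ρ' := ball_subset_ball hρ
  have := h φ hφ (hs.trans hsub) i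
  rw [setIntegral_eq_of_subset_of_forall_sdiff_eq_zero measurableSet_ball hsub
    (fun x hx => by rw [hz' x hx.2]; simp), setIntegral_eq_of_subset_of_forall_sdiff_eq_zero
    measurableSet_ball hsub (fun x hx => by rw [hz x hx.2, zero_mul])] at this
  exact this

lemma IsWeakGrad.ae_eq {ρ : ℝ} {v : E2 → ℝ} {g g' : E2 → E2} (h : IsWeakGrad (ball 0 ρ) v g)
    (h' : IsWeakGrad (ball 0 ρ) v g') (hg : IntegrableOn g (ball 0 ρ) volume)
    (hg' : IntegrableOn g' (ball 0 ρ) volume) : ∀ᵐ x, x ∈ ball (0 : E2) ρ → g x = g' x := by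
  have hcoord : ∀ {f : E2 → E2}, IntegrableOn f (ball 0 ρ) volume → ∀ i,
      IntegrableOn (fun x => f x i) (ball 0 ρ) volume := fun hf i =>
    ContinuousLinearMap.integrable_comp (EuclideanSpace.proj (𝕜 := ℝ) i : E2 →L[ℝ] ℝ) hf
  have key : ∀ i, ∀ᵐ x, x ∈ ball (0 : E2) ρ → g x i - g' x i = 0 := fun i => by
    refine isOpen_ball.ae_eq_zero_of_integral_contDiff_smul_eq_zero
      ((hcoord hg i).sub (hcoord hg' i)).locallyIntegrableOn fun φ hφ hc hs => ?_
    have hz : ∀ x ∉ ball (0 : E2) ρ, φ x = 0 := fun x hx =>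
      image_eq_zero_of_notMem_tsupport fun hx' => hx (hs hx')
    obtain ⟨K, hK⟩ := hφ.continuous.bounded_above_of_compact_support hc
    have hfi : ∀ f : E2 → ℝ, IntegrableOn f (ball 0 ρ) volume →
        Integrable (fun x => φ x * f x) (volume.restrict (ball 0 ρ)) := fun f hf =>
      hf.bdd_mul (c := K) hφ.continuous.aestronglyMeasurable (Eventually.of_forall hK)
    rw [← setIntegral_eq_integral_of_forall_compl_eq_zero (s := ball 0 ρ)
      fun x hx => by rw [hz x hx, zero_smul]]
    simp only [smul_eq_mul, mul_sub]
    rw [integral_sub (hfi _ (hcoord hg i)) (hfi _ (hcoord hg' i)), sub_eq_zero]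
    exact neg_injective ((h φ ⟨hφ, hc⟩ hs i).symm.trans (h' φ ⟨hφ, hc⟩ hs i))
  filter_upwards [ae_all_iff.2 key] with x hx hxB
  ext i
  exact sub_eq_zero.1 (hx i hxB)

open Classical in
/-- Weak gradients on an exhaustion of the disk patch together. -/
lemma exists_isWeakGrad_of_exhaustion {ρ : ℕ → ℝ} (hρ : Monotone ρ) (hρ1 : ∀ n, ρ n < 1)
    (hlim : Tendsto ρ atTop (𝓝 1)) {v : E2 → ℝ} {g : ℕ → E2 → E2}
    (hg : ∀ n, IsWeakGrad (ball 0 (ρ n)) v (g n))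
    (hgi : ∀ n, IntegrableOn (g n) (ball 0 (ρ n)) volume) :
    ∃ dv : E2 → E2, IsWeakGrad (ball 0 1) v dv ∧
      ∀ᵐ x, x ∈ ball (0 : E2) (ρ 0) → dv x = g 0 x := by
  have hsub : ∀ {m n}, m ≤ n → ball (0 : E2) (ρ m) ⊆ ball 0 (ρ n) := fun h =>
    ball_subset_ball (hρ h)
  set dv : E2 → E2 := fun x => if h : ∃ n, x ∈ ball (0 : E2) (ρ n) then g (Nat.find h) x else 0
    with hdv
  have hcons : ∀ᵐ x, ∀ m n, m ≤ n → x ∈ ball (0 : E2) (ρ m) → g m x = g n x := by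
    refine ae_all_iff.2 fun m => ae_all_iff.2 fun n => ?_
    by_cases hmn : m ≤ n
    · filter_upwards [(hg m).ae_eq ((hg n).mono (hρ hmn)) (hgi m)
        ((hgi n).mono_set (hsub hmn))] with x hx _ using hx
    · exact Eventually.of_forall fun x h => absurd h hmn
  have hae : ∀ᵐ x, ∀ n, x ∈ ball (0 : E2) (ρ n) → dv x = g n x := by
    filter_upwards [hcons] with x hx n hxn
    have h : ∃ n, x ∈ ball (0 : E2) (ρ n) := ⟨n, hxn⟩
    simp only [hdv, dif_pos h]
    exact hx _ _ (Nat.find_min' h hxn) (Nat.find_spec h)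
  refine ⟨dv, fun φ hφ hs i => ?_, hae.mono fun x hx => hx 0⟩
  have hcover : tsupport φ ⊆ ⋃ n, ball (0 : E2) (ρ n) := fun x hx => by
    have h1 : ‖x‖ < 1 := by simpa using hs hx
    obtain ⟨n, hn⟩ := (hlim.eventually (lt_mem_nhds h1)).exists
    exact mem_iUnion.2 ⟨n, by simpa using hn⟩
  obtain ⟨n, hn⟩ := IsCompact.elim_directed_cover hφ.2 _ (fun n => isOpen_ball) hcover
    (directed_of_isDirected_le fun m n h => hsub h)
  have hn1 : ball (0 : E2) (ρ n) ⊆ ball 0 1 := ball_subset_ball (hρ1 n).le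
  have hz : ∀ x ∉ ball (0 : E2) (ρ n), φ x = 0 := fun x hx =>
    image_eq_zero_of_notMem_tsupport fun hx' => hx (hn hx')
  have hz' : ∀ x ∉ ball (0 : E2) (ρ n), fderiv ℝ φ x = 0 := fun x hx =>
    image_eq_zero_of_notMem_tsupport fun hx' => hx (hn (tsupport_fderiv_subset ℝ hx'))
  rw [setIntegral_eq_of_subset_of_forall_sdiff_eq_zero measurableSet_ball hn1
    (fun x hx => by rw [hz' x hx.2]; simp), setIntegral_eq_of_subset_of_forall_sdiff_eq_zero
    measurableSet_ball hn1 (fun x hx => by rw [hz x hx.2, zero_mul]), hg n φ hφ hn i]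
  congr 1
  refine setIntegral_congr_ae measurableSet_ball ?_
  filter_upwards [hae] with x hx hxB
  rw [hx n hxB]

lemma integral_le_toReal_of_lintegral_le {m : Measure E2} {f : E2 → ℝ} {B : ℝ≥0∞} (hf : ∀ x, 0 ≤ f x)
    (hB : B ≠ ∞) (h : ∫⁻ x, ENNReal.ofReal (f x) ∂m ≤ B) : ∫ x, f x ∂m ≤ B.toReal := by
  by_cases hi : Integrable f m
  · rw [integral_eq_lintegral_of_nonneg_ae (Eventually.of_forall hf) hi.1]
    exact ENNReal.toReal_mono hB h
  · rw [integral_undef hi]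
    exact ENNReal.toReal_nonneg

lemma setLIntegral_le_of_ae_le {f g : E2 → ℝ} {c : ℝ} {B : ℝ≥0∞} {ρ : ℝ} (hρ : ρ ≤ 1) (hc : 0 ≤ c)
    (h : ∀ᵐ x ∂volume.restrict (ball (0 : E2) ρ), f x ≤ c * g x)
    (hB : ∫⁻ x in ball (0 : E2) 1, ENNReal.ofReal (g x) ≤ B) :
    ∫⁻ x in ball (0 : E2) ρ, ENNReal.ofReal (f x) ≤ ENNReal.ofReal c * B := by
  calc ∫⁻ x in ball (0 : E2) ρ, ENNReal.ofReal (f x)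
      ≤ ∫⁻ x in ball (0 : E2) ρ, ENNReal.ofReal c * ENNReal.ofReal (g x) := by
        refine lintegral_mono_ae (h.mono fun x hx => ?_)
        rw [← ENNReal.ofReal_mul hc]
        exact ENNReal.ofReal_le_ofReal hx
    _ = ENNReal.ofReal c * ∫⁻ x in ball (0 : E2) ρ, ENNReal.ofReal (g x) :=
        lintegral_const_mul' _ _ ENNReal.ofReal_ne_top
    _ ≤ ENNReal.ofReal c * ∫⁻ x in ball (0 : E2) 1, ENNReal.ofReal (g x) := by
        gcongr
    _ ≤ _ := by gcongr

lemma real_tv_restrict_le {μ : SignedMeasure E2} {s : Set E2} {τ : ℝ} (hτ : 0 ≤ τ)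
    (h : tv μ s < ENNReal.ofReal τ) : ((tv μ).restrict s).real univ ≤ τ := by
  rw [measureReal_def, Measure.restrict_apply_univ]
  exact ENNReal.toReal_le_of_le_ofReal hτ h.le

/-- **Corollary 2.3, part 2.** Exponential integrability `∫_{D_{1/2}} e^{p|u|} ≤ β(τ,p,γ)`
for `p < 4π/τ`, and a `W^{1,q}` bound for `e^u` below a threshold total mass `τ₀(q)`. -/
theorem exp_integrability_and_W1q_of_exp :
    (∀ (τ γ p : ℝ), 0 < τ → 0 < γ → p < 4 * Real.pi / τ →
      ∃ β : ℝ,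
        ∀ (μ : SignedMeasure E2) (u : E2 → ℝ),
          IntegrableOn u (ball (0:E2) 1) volume →
          WeakPoisson (ball (0:E2) 1) u μ →
          tv μ (ball (0:E2) 1) < ENNReal.ofReal τ →
          (∫ x in ball (0:E2) 1, |u x|) < γ →
          (∫ x in ball (0:E2) (1/2), Real.exp (p * |u x|)) ≤ β) ∧
    (∀ q ∈ Set.Ico (1:ℝ) 2, ∃ τ₀ : ℝ, 0 < τ₀ ∧
      ∀ γ : ℝ, 0 < γ → ∃ β' : ℝ,
        ∀ (μ : SignedMeasure E2) (u : E2 → ℝ),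
          IntegrableOn u (ball (0:E2) 1) volume →
          WeakPoisson (ball (0:E2) 1) u μ →
          tv μ (ball (0:E2) 1) < ENNReal.ofReal τ₀ →
          (∫ x in ball (0:E2) 1, |u x|) < γ →
          ∃ dv : E2 → E2,
            IsWeakGrad (ball (0:E2) 1) (fun x => Real.exp (u x)) dv ∧
            (∫ x in ball (0:E2) (1/2), Real.exp (u x) ^ q) ^ (1/q)
                + (∫ x in ball (0:E2) (1/2), ‖dv x‖ ^ q) ^ (1/q) ≤ β') := by

  refine ⟨fun τ γ p hτ hγ hpτ => ?_, fun q hq => ?_⟩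
  · obtain ⟨C, hC0, hC⟩ := exists_approx (ρ := 1 / 2) (by norm_num) (by norm_num)
    rcases le_or_gt p 0 with hp | hp
    · refine ⟨(volume (ball (0 : E2) (1 / 2))).toReal, fun μ u _ _ _ _ =>
        integral_le_toReal_of_lintegral_le (fun x => (Real.exp_pos _).le)
          measure_ball_lt_top.ne ?_⟩
      rw [← one_mul (volume (ball (0 : E2) (1 / 2))), ← setLIntegral_const]
      refine lintegral_mono fun x => ENNReal.ofReal_le_one.2 (Real.exp_le_one_iff.2 ?_)
      exact mul_nonpos_of_nonpos_of_nonneg hp (abs_nonneg _)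
    · obtain ⟨B, hB, H⟩ := exists_lintegral_exp_logPot_le (τ := τ) hp ((lt_div_iff₀ hτ).1 hpτ)
      refine ⟨(ENNReal.ofReal (Real.exp (p * (C * γ))) * B).toReal, fun μ u hu hw hμ huγ => ?_⟩
      obtain ⟨U, dU, dw, -, -, -, h⟩ := hC μ u hu hw
      refine integral_le_toReal_of_lintegral_le (fun x => (Real.exp_pos _).le)
        (ENNReal.mul_ne_top ENNReal.ofReal_ne_top hB) (setLIntegral_le_of_ae_le (by norm_num)
          (Real.exp_pos _).le ?_ (H ((tv μ).restrict (ball 0 1))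
            (ae_restrict_mem measurableSet_ball) (real_tv_restrict_le hτ.le hμ)))
      filter_upwards [h] with x hx
      have h1 := le_of_tendsto hx.1.abs (Eventually.of_forall hx.2.2.1)
      rw [← Real.exp_add, Real.exp_le_exp, ← mul_add, add_comm]
      gcongr
      exact h1.trans (by gcongr)
  · obtain ⟨hq1, hq2⟩ := hq
    obtain ⟨τ₀, hτ₀, H⟩ := exists_lintegral_majorant_rpow_le hq1 hq2
    refine ⟨τ₀, hτ₀, fun γ hγ => ?_⟩
    set ρ : ℕ → ℝ := fun n => 1 - 1 / (n + 2) with hρdef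
    have hρ0 : ρ 0 = 1 / 2 := by norm_num [hρdef]
    have hρmono : Monotone ρ := fun m n hmn => by
      simp only [hρdef]
      gcongr
    have hρpos : ∀ n, 0 < ρ n := fun n => by
      have := hρmono (Nat.zero_le n)
      rw [hρ0] at this
      linarith
    have hρ1 : ∀ n, ρ n < 1 := fun n => sub_lt_self _ (by positivity)
    have hρlim : Tendsto ρ atTop (𝓝 1) := by
      have := (tendsto_const_div_atTop_nhds_zero_nat (1 : ℝ)).comp (tendsto_add_atTop_nat 2)
      simpa [hρdef, Function.comp_def] using (tendsto_const_nhds (x := (1 : ℝ))).sub this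
    choose C hC0 hC using fun n => exists_approx (hρpos n) (hρ1 n)
    have hM : ∀ n, 0 ≤ C n * γ := fun n => mul_nonneg (hC0 n) hγ.le
    choose B hB HB using fun n => H (C n * γ) (hM n)
    refine ⟨(ENNReal.ofReal 1 * B 0).toReal ^ (1 / q) +
      (ENNReal.ofReal (2 ^ q) * B 0).toReal ^ (1 / q), fun μ u hu hw hμ huγ => ?_⟩
    set ν := (tv μ).restrict (ball 0 1)
    have hmaj : ∀ n, ∫⁻ x in ball (0 : E2) 1, ENNReal.ofReal (majorant (C n * γ) ν x ^ q) ≤ B n :=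
      fun n => HB n ν (ae_restrict_mem measurableSet_ball) (real_tv_restrict_le hτ₀.le hμ)
    have hloc : ∀ n, ∃ g : E2 → E2, IsWeakGrad (ball 0 (ρ n)) (fun x => Real.exp (u x)) g ∧
        IntegrableOn g (ball 0 (ρ n)) volume ∧
        ∀ᵐ x ∂volume.restrict (ball (0 : E2) (ρ n)), Real.exp (u x) ≤ majorant (C n * γ) ν x ∧
          ‖g x‖ ≤ 2 * majorant (C n * γ) ν x := fun n => by
      obtain ⟨U, dU, dw, hU, hdU, hD, h⟩ := hC n μ u hu hw
      refine exists_isWeakGrad_exp (dw := dw) hU hdU hD ((integrableOn_majorant (hM n) hq1 ν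
        ((hmaj n).trans_lt (hB n).lt_top).ne).mono_set (ball_subset_ball (hρ1 n).le)) ?_
      filter_upwards [h] with x ⟨h1, h2, h3, h4⟩
      have hCI : C n * ∫ y in ball (0 : E2) 1, |u y| ≤ C n * γ := by
        have := hC0 n
        gcongr
      have h3' : ∀ k, |U k x| ≤ logPot ν x + C n * γ := fun k => (h3 k).trans (by gcongr)
      exact ⟨h1, h2, fun k => ⟨exp_le_majorant (hM n) ν (h3' k), fun i =>
        abs_exp_mul_le_majorant ν (h3' k) ((h4 k i).trans (by gcongr))⟩⟩
    choose g hg hgi hgb using hloc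
    obtain ⟨dv, hdv, hdv0⟩ := exists_isWeakGrad_of_exhaustion hρmono hρ1 hρlim hg hgi
    refine ⟨dv, hdv, ?_⟩
    have hb := hgb 0
    rw [← ae_restrict_iff' measurableSet_ball] at hdv0
    rw [hρ0] at hb hdv0
    have hq0 : 0 ≤ q := by linarith
    have hle : (1 : ℝ) / 2 ≤ 1 := by norm_num
    gcongr
    · refine integral_le_toReal_of_lintegral_le (fun x => by positivity)
        (ENNReal.mul_ne_top ENNReal.ofReal_ne_top (hB 0))
        (setLIntegral_le_of_ae_le hle zero_le_one ?_ (hmaj 0))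
      filter_upwards [hb] with x hx
      rw [one_mul]
      gcongr
      exact hx.1
    · refine integral_le_toReal_of_lintegral_le (fun x => by positivity)
        (ENNReal.mul_ne_top ENNReal.ofReal_ne_top (hB 0))
        (setLIntegral_le_of_ae_le hle (by positivity) ?_ (hmaj 0))
      filter_upwards [hb, hdv0] with x hx hx'
      rw [hx', ← Real.mul_rpow zero_le_two (majorant_nonneg (hM 0) ν x)]
      gcongr
      exact hx.2
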